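/- arXiv:1506.04181 — 3 statements merged into one kernel-verified Lean document; each statement's English description precedes it below -/
import Mathlib

section
/- (Rough Leibniz lemma for $|D|^\alpha$, $\alpha < 1$.) Let $\frac{1}{2} < \alpha < 1$ and $n \geq 1$ an integer. There is a constant $C_n > 0$ independent of $\alpha$ such that for all $u \in H^{\alpha+n}(\mathbb{T})$, $\|\bar{u}|D|^\alpha u + u |D|^\alpha \bar{u} - |D|^\alpha(|u|^2)\|_{H^n} \leq C_n \|u\|_{H^\alpha}^{1 + \frac{1}{n}(\alpha - \frac{1}{2})} \|u\|_{H^{\alpha+n}}^{1 - \frac{1}{n}(\alpha - \frac{1}{2})}$. -/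
open Real Complex MeasureTheory

noncomputable section

instance : Fact (0 < 2 * π) := ⟨by positivity⟩

/-- The one-dimensional torus. -/
abbrev Torus := AddCircle (2 * π)

/-- Sobolev norm `‖w‖_{H^s}` via Fourier coefficients. -/
def sobNorm (s : ℝ) (w : Torus → ℂ) : ℝ :=
  Real.sqrt (∑' k : ℤ, (1 + |(k : ℝ)| ^ 2) ^ s * ‖fourierCoeff w k‖ ^ 2)

/-- The Fourier multiplier `|D|^ρ`. -/
def fracD (ρ : ℝ) (w : Torus → ℂ) : Torus → ℂ :=
  fun x => ∑' k : ℤ, ((|(k : ℝ)| ^ ρ : ℝ) : ℂ) * fourierCoeff w k * fourier k x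

open scoped ENNReal

section Weights

/-- The weight `(1 + |k|²)^s` of the Sobolev norm of order `s`. -/
def sobWeight (s : ℝ) (k : ℤ) : ℝ := (1 + |(k : ℝ)| ^ 2) ^ s

lemma one_le_one_add_abs_sq (k : ℤ) : 1 ≤ 1 + |(k : ℝ)| ^ 2 := by
  have := sq_nonneg |(k : ℝ)|
  linarith

lemma sobWeight_pos (s : ℝ) (k : ℤ) : 0 < sobWeight s k :=
  Real.rpow_pos_of_pos (by linarith [one_le_one_add_abs_sq k]) _

lemma sobWeight_mul (s t : ℝ) (k : ℤ) :
    sobWeight s k * sobWeight t k = sobWeight (s + t) k :=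
  (Real.rpow_add (by linarith [one_le_one_add_abs_sq k]) _ _).symm

lemma sobWeight_rpow (s t : ℝ) (k : ℤ) : sobWeight s k ^ t = sobWeight (s * t) k :=
  (Real.rpow_mul (by linarith [one_le_one_add_abs_sq k]) _ _).symm

lemma sobWeight_sq (s : ℝ) (k : ℤ) : sobWeight s k ^ 2 = sobWeight (2 * s) k := by
  rw [sq, sobWeight_mul, two_mul]

lemma sobWeight_neg (s : ℝ) (k : ℤ) : sobWeight s (-k) = sobWeight s k := by
  simp [sobWeight]

lemma sobWeight_mono {s t : ℝ} (h : s ≤ t) (k : ℤ) : sobWeight s k ≤ sobWeight t k :=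
  Real.rpow_le_rpow_of_exponent_le (one_le_one_add_abs_sq k) h

lemma one_le_sobWeight {s : ℝ} (h : 0 ≤ s) (k : ℤ) : 1 ≤ sobWeight s k :=
  Real.one_le_rpow (one_le_one_add_abs_sq k) h

lemma abs_rpow_le_sobWeight {ρ : ℝ} (h : 0 ≤ ρ) (k : ℤ) :
    |(k : ℝ)| ^ ρ ≤ sobWeight (ρ / 2) k := by
  have h1 : |(k : ℝ)| ^ ρ = (|(k : ℝ)| ^ 2) ^ (ρ / 2) := by
    rw [← Real.rpow_natCast, ← Real.rpow_mul (abs_nonneg _)]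
    congr 1
    push_cast
    ring
  rw [h1]
  exact Real.rpow_le_rpow (by positivity) (by linarith) (by positivity)

lemma sobWeight_add_le {s : ℝ} (hs : 0 ≤ s) {l p : ℤ} (h : |p| ≤ |l|) :
    sobWeight s (l + p) ≤ 4 ^ s * sobWeight s l := by
  have hr : |(p : ℝ)| ≤ |(l : ℝ)| := by exact_mod_cast h
  unfold sobWeight
  rw [← Real.mul_rpow (by norm_num) (by positivity)]
  refine Real.rpow_le_rpow (by positivity) ?_ hs
  push_cast
  have h1 := abs_add_le (l : ℝ) p
  have h2 := abs_nonneg ((l : ℝ) + p)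
  nlinarith [abs_nonneg (l : ℝ), abs_nonneg (p : ℝ)]

lemma sobWeight_neg_half_mul_le (l : ℤ) : sobWeight (-(1 / 2)) l * (2 * |(l : ℝ)| + 1) ≤ 3 := by
  have h1 : |(l : ℝ)| ≤ sobWeight (1 / 2) l := by
    simpa using abs_rpow_le_sobWeight (ρ := 1) zero_le_one l
  have h2 : 1 ≤ sobWeight (1 / 2) l := one_le_sobWeight (by norm_num) l
  have h3 : sobWeight (-(1 / 2)) l * sobWeight (1 / 2) l = 1 := by
    rw [sobWeight_mul]; simp [sobWeight]
  have h4 := sobWeight_pos (-(1 / 2)) l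
  nlinarith

lemma summable_sobWeight_neg_one : Summable (sobWeight (-1)) := by
  have h : Summable fun k : ℤ => 2 * (1 / (k : ℝ) ^ 2) :=
    (Real.summable_one_div_int_pow.mpr one_lt_two).mul_left 2
  refine Summable.of_norm_bounded_eventually h ?_
  filter_upwards [(Set.finite_singleton (0 : ℤ)).compl_mem_cofinite] with k hk
  have hk0 : (k : ℝ) ≠ 0 := by exact_mod_cast hk
  rw [Real.norm_of_nonneg (sobWeight_pos _ _).le, sobWeight, Real.rpow_neg_one, sq_abs,
    inv_eq_one_div, mul_one_div]
  have : 0 < (k : ℝ) ^ 2 := by positivity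
  rw [div_le_div_iff₀ (by positivity) this]
  nlinarith

/-- The symbol of the commutator is controlled by either of the two frequencies. -/
lemma abs_rpow_add_sub_le {α : ℝ} (h0 : 0 < α) (h1 : α < 1) (x y : ℝ) :
    |(|x| ^ α + |y| ^ α - |x + y| ^ α)| ≤ 2 * |y| ^ α := by
  have sub (s t : ℝ) : |s + t| ^ α ≤ |s| ^ α + |t| ^ α :=
    (Real.rpow_le_rpow (abs_nonneg _) (abs_add_le s t) h0.le).trans
      (Real.rpow_add_le_add_rpow (abs_nonneg _) (abs_nonneg _) h0.le h1.le)
  have h2 := sub x y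
  have h3 := sub (x + y) (-y)
  rw [add_neg_cancel_right, abs_neg] at h3
  rw [abs_of_nonneg (by linarith)]
  linarith

lemma commutator_symbol_le {α : ℝ} (h0 : 0 < α) (h1 : α < 1) {s : ℝ} (hs : 0 ≤ s)
    {l p : ℤ} (h : |p| ≤ |l|) :
    sobWeight s (l + p) * |(|(l : ℝ)| ^ α + |(p : ℝ)| ^ α - |((l + p : ℤ) : ℝ)| ^ α)| ≤
      2 * 4 ^ s * (sobWeight s l * sobWeight (α / 2) p) := by
  have e1 := sobWeight_add_le hs h
  have e2 := (abs_rpow_add_sub_le h0 h1 (l : ℝ) p).trans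
    (mul_le_mul_of_nonneg_left (abs_rpow_le_sobWeight h0.le p) two_pos.le)
  push_cast
  calc _ ≤ (4 ^ s * sobWeight s l) * (2 * sobWeight (α / 2) p) :=
        mul_le_mul e1 e2 (abs_nonneg _)
          (mul_nonneg (by positivity) (sobWeight_pos _ _).le)
    _ = _ := by ring

end Weights

section Paraproduct

lemma ENNReal.tsum_mul_sq_le {ι : Type*} (f g : ι → ℝ≥0∞) :
    (∑' i, f i * g i) ^ 2 ≤ (∑' i, f i ^ 2) * ∑' i, g i ^ 2 := by
  let _ : MeasurableSpace ι := ⊤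
  have h := ENNReal.lintegral_mul_norm_pow_le (μ := Measure.count) (f := fun i => f i ^ 2)
    (g := fun i => g i ^ 2) (measurable_from_top.aemeasurable) (measurable_from_top.aemeasurable)
    (p := 1 / 2) (q := 1 / 2) (by norm_num) (by norm_num) (by norm_num)
  have e (x : ℝ≥0∞) : (x ^ 2) ^ (1 / 2 : ℝ) = x := by
    rw [← ENNReal.rpow_natCast, ← ENNReal.rpow_mul]; norm_num
  have e' (x : ℝ≥0∞) : (x ^ (1 / 2 : ℝ)) ^ 2 = x := by
    rw [← ENNReal.rpow_natCast, ← ENNReal.rpow_mul]; norm_num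
  simp only [lintegral_count, e] at h
  calc _ ≤ _ := pow_le_pow_left' h 2
    _ = _ := by rw [mul_pow, e', e']

/-- The part of the convolution of `f` and `g` at frequency `k` in which `g` carries the lower
frequency, weighted by the inverse square root of the higher one. -/
def lowHighConv (f g : ℤ → ℝ≥0∞) (k : ℤ) : ℝ≥0∞ :=
  ∑' l : ℤ, if |k - l| ≤ |l| then
    ENNReal.ofReal (sobWeight (-(1 / 4)) l) * f l * g (k - l) else 0

lemma tsum_lowHighConv_sq_le (f g : ℤ → ℝ≥0∞) :
    ∑' k, lowHighConv f g k ^ 2 ≤ 3 * (∑' l, f l ^ 2) * ∑' p, g p ^ 2 := by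
  have hk (k : ℤ) : lowHighConv f g k ^ 2 ≤
      (∑' l : ℤ, if |k - l| ≤ |l| then
        ENNReal.ofReal (sobWeight (-(1 / 2)) l) * f l ^ 2 else 0) * ∑' p, g p ^ 2 := by
    have h := ENNReal.tsum_mul_sq_le (fun l : ℤ => if |k - l| ≤ |l| then
      ENNReal.ofReal (sobWeight (-(1 / 4)) l) * f l else 0) (fun l => g (k - l))
    have hg : ∑' l, g (k - l) ^ 2 = ∑' p, g p ^ 2 :=
      (Equiv.subLeft k).tsum_eq (fun p => g p ^ 2)
    rw [hg] at h
    have e (l : ℤ) : (if |k - l| ≤ |l| then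
          ENNReal.ofReal (sobWeight (-(1 / 4)) l) * f l else 0) ^ 2 =
        if |k - l| ≤ |l| then
          ENNReal.ofReal (sobWeight (-(1 / 2)) l) * f l ^ 2 else 0 := by
      split_ifs
      · rw [mul_pow, ← ENNReal.ofReal_pow (sobWeight_pos _ _).le, sobWeight_sq]
        norm_num
      · simp
    simpa only [e, ite_mul, zero_mul, lowHighConv] using h
  calc _ ≤ _ := ENNReal.tsum_le_tsum hk
    _ = (∑' l : ℤ, ∑' k : ℤ, if |k - l| ≤ |l| then
        ENNReal.ofReal (sobWeight (-(1 / 2)) l) * f l ^ 2 else 0) * ∑' p, g p ^ 2 := by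
      rw [ENNReal.tsum_mul_right, ENNReal.tsum_comm]
    _ ≤ _ := by
      gcongr
      rw [← ENNReal.tsum_mul_left]
      refine ENNReal.tsum_le_tsum fun l => ?_
      have hcard : (∑' k : ℤ, if |k - l| ≤ |l| then
          ENNReal.ofReal (sobWeight (-(1 / 2)) l) * f l ^ 2 else 0) =
          ((Finset.Icc (l - |l|) (l + |l|)).card : ℝ≥0∞) *
            (ENNReal.ofReal (sobWeight (-(1 / 2)) l) * f l ^ 2) := by
        rw [tsum_eq_sum (s := Finset.Icc (l - |l|) (l + |l|))]
        · rw [Finset.sum_congr rfl (g := fun _ =>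
            ENNReal.ofReal (sobWeight (-(1 / 2)) l) * f l ^ 2), Finset.sum_const, nsmul_eq_mul]
          intro k hk
          rw [Finset.mem_Icc] at hk
          rw [if_pos (abs_le.mpr ⟨by linarith, by linarith⟩)]
        · intro k hk
          rw [if_neg]
          contrapose! hk
          have := abs_le.mp hk
          exact Finset.mem_Icc.mpr ⟨by linarith, by linarith⟩
      rw [hcard, ← mul_assoc]
      gcongr
      have hc : ((Finset.Icc (l - |l|) (l + |l|)).card : ℝ) = 2 * |(l : ℝ)| + 1 := by
        have h0 : (((Finset.Icc (l - |l|) (l + |l|)).card : ℤ)) = 2 * |l| + 1 := by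
          rw [Int.card_Icc, Int.toNat_of_nonneg (by linarith [abs_nonneg l])]
          ring
        exact_mod_cast h0
      rw [← ENNReal.ofReal_natCast, ← ENNReal.ofReal_mul (by positivity), hc, mul_comm,
        show (3 : ℝ≥0∞) = ENNReal.ofReal 3 by simp]
      exact ENNReal.ofReal_le_ofReal (sobWeight_neg_half_mul_le l)

end Paraproduct

section SobolevEnergy

/-- The squared Sobolev norm of order `s` of a sequence of Fourier coefficients, with values in
the extended nonnegative reals. -/
def sobEnergy (s : ℝ) (a : ℤ → ℂ) : ℝ≥0∞ :=
  ∑' k : ℤ, ENNReal.ofReal (sobWeight s k) * ‖a k‖ₑ ^ 2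

lemma sobEnergy_term (s : ℝ) (a : ℤ → ℂ) (k : ℤ) :
    ENNReal.ofReal (sobWeight s k) * ‖a k‖ₑ ^ 2 =
      ENNReal.ofReal (sobWeight s k * ‖a k‖ ^ 2) := by
  rw [ENNReal.ofReal_mul (sobWeight_pos _ _).le, ENNReal.ofReal_pow (norm_nonneg _),
    ofReal_norm]

lemma sobEnergy_toReal (s : ℝ) (a : ℤ → ℂ) :
    (sobEnergy s a).toReal = ∑' k : ℤ, sobWeight s k * ‖a k‖ ^ 2 := by
  simp only [sobEnergy, sobEnergy_term]
  rw [ENNReal.tsum_toReal_eq (fun _ => ENNReal.ofReal_ne_top)]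
  exact tsum_congr fun k => ENNReal.toReal_ofReal
    (mul_nonneg (sobWeight_pos _ _).le (sq_nonneg _))

lemma sobNorm_eq (s : ℝ) (w : Torus → ℂ) :
    sobNorm s w = Real.sqrt (sobEnergy s (fourierCoeff w)).toReal := by
  rw [sobEnergy_toReal]; rfl

lemma sobEnergy_ne_top {s : ℝ} {a : ℤ → ℂ}
    (h : Summable fun k : ℤ => sobWeight s k * ‖a k‖ ^ 2) : sobEnergy s a ≠ ⊤ := by
  simp only [sobEnergy, sobEnergy_term]
  exact h.tsum_ofReal_ne_top

lemma sobEnergy_mono {s t : ℝ} (h : s ≤ t) (a : ℤ → ℂ) : sobEnergy s a ≤ sobEnergy t a :=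
  ENNReal.tsum_le_tsum fun k => by
    gcongr
    exact sobWeight_mono h k

lemma sobEnergy_conj_neg (s : ℝ) (a : ℤ → ℂ) :
    sobEnergy s (fun k => starRingEnd ℂ (a (-k))) = sobEnergy s a := by
  unfold sobEnergy
  rw [← (Equiv.neg ℤ).tsum_eq]
  simp [sobWeight_neg]

lemma sobEnergy_eq_tsum_sq (s : ℝ) (a : ℤ → ℂ) :
    sobEnergy s a = ∑' k : ℤ, (ENNReal.ofReal (sobWeight (s / 2) k) * ‖a k‖ₑ) ^ 2 := by
  refine tsum_congr fun k => ?_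
  rw [mul_pow, ← ENNReal.ofReal_pow (sobWeight_pos _ _).le, sobWeight_sq,
    mul_div_cancel₀ _ two_ne_zero]

lemma sobEnergy_interpolation {s t θ : ℝ} (h0 : 0 ≤ θ) (h1 : θ ≤ 1) (a : ℤ → ℂ) :
    sobEnergy (s * θ + t * (1 - θ)) a ≤ sobEnergy s a ^ θ * sobEnergy t a ^ (1 - θ) := by
  have h := ENNReal.lintegral_mul_norm_pow_le (μ := Measure.count)
    (f := fun k : ℤ => ENNReal.ofReal (sobWeight s k) * ‖a k‖ₑ ^ 2)
    (g := fun k : ℤ => ENNReal.ofReal (sobWeight t k) * ‖a k‖ₑ ^ 2)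
    (measurable_from_top.aemeasurable) (measurable_from_top.aemeasurable)
    h0 (sub_nonneg.mpr h1) (by ring)
  simp only [lintegral_count] at h
  refine le_of_eq_of_le (tsum_congr fun k => ?_) h
  rw [ENNReal.mul_rpow_of_nonneg _ _ h0, ENNReal.mul_rpow_of_nonneg _ _ (sub_nonneg.mpr h1),
    mul_mul_mul_comm, ← ENNReal.rpow_add_of_nonneg _ _ h0 (sub_nonneg.mpr h1),
    ENNReal.ofReal_rpow_of_pos (sobWeight_pos _ _), ENNReal.ofReal_rpow_of_pos (sobWeight_pos _ _),
    sobWeight_rpow, sobWeight_rpow, ← ENNReal.ofReal_mul (sobWeight_pos _ _).le, sobWeight_mul]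
  simp

end SobolevEnergy

section CommutatorSequence

/-- The Fourier coefficients of `v |D|^α u + u |D|^α v - |D|^α (u v)`, where `a` and `b` are the
Fourier coefficients of `u` and `v`. -/
def commutatorCoeff (α : ℝ) (a b : ℤ → ℂ) (k : ℤ) : ℂ :=
  ∑' l : ℤ, ((|(l : ℝ)| ^ α + |((k - l : ℤ) : ℝ)| ^ α - |(k : ℝ)| ^ α : ℝ) : ℂ) *
    (a l * b (k - l))

lemma weighted_commutator_term_le {α : ℝ} (h0 : 0 < α) (h1 : α < 1) {s : ℝ} (hs : 0 ≤ s)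
    {l p : ℤ} (h : |p| ≤ |l|) (x y : ℂ) :
    ENNReal.ofReal (sobWeight s (l + p)) *
        ‖((|(l : ℝ)| ^ α + |(p : ℝ)| ^ α - |((l + p : ℤ) : ℝ)| ^ α : ℝ) : ℂ) * (x * y)‖ₑ ≤
      ENNReal.ofReal (2 * 4 ^ s) * (ENNReal.ofReal (sobWeight (-(1 / 4)) l) *
        (ENNReal.ofReal (sobWeight (s + 1 / 4) l) * ‖x‖ₑ) *
        (ENNReal.ofReal (sobWeight (α / 2) p) * ‖y‖ₑ)) := by
  have e : sobWeight (-(1 / 4)) l * sobWeight (s + 1 / 4) l = sobWeight s l := by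
    rw [sobWeight_mul]; congr 1; ring
  have hw := fun (r : ℝ) (k : ℤ) => (sobWeight_pos r k).le
  have hC : (0 : ℝ) ≤ 2 * 4 ^ s := by positivity
  simp only [← ofReal_norm]
  rw [← ENNReal.ofReal_mul (hw _ _), ← ENNReal.ofReal_mul (hw _ _), ← ENNReal.ofReal_mul (hw _ _),
    ← ENNReal.ofReal_mul (hw _ _),
    ← ENNReal.ofReal_mul (mul_nonneg (hw _ _) (mul_nonneg (hw _ _) (norm_nonneg _))),
    ← ENNReal.ofReal_mul hC]
  refine ENNReal.ofReal_le_ofReal ?_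
  rw [norm_mul, Complex.norm_real, Real.norm_eq_abs, norm_mul, ← mul_assoc]
  calc _ ≤ (2 * 4 ^ s * (sobWeight s l * sobWeight (α / 2) p)) * (‖x‖ * ‖y‖) :=
        mul_le_mul_of_nonneg_right (commutator_symbol_le h0 h1 hs h) (by positivity)
    _ = _ := by rw [← e]; ring

lemma weighted_commutatorCoeff_le {α : ℝ} (h0 : 0 < α) (h1 : α < 1) {s : ℝ} (hs : 0 ≤ s)
    (a b : ℤ → ℂ) (k : ℤ) :
    ENNReal.ofReal (sobWeight s k) * ‖commutatorCoeff α a b k‖ₑ ≤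
      ENNReal.ofReal (2 * 4 ^ s) *
        (lowHighConv (fun l => ENNReal.ofReal (sobWeight (s + 1 / 4) l) * ‖a l‖ₑ)
            (fun p => ENNReal.ofReal (sobWeight (α / 2) p) * ‖b p‖ₑ) k +
          lowHighConv (fun l => ENNReal.ofReal (sobWeight (s + 1 / 4) l) * ‖b l‖ₑ)
            (fun p => ENNReal.ofReal (sobWeight (α / 2) p) * ‖a p‖ₑ) k) := by
  have hflip : ∀ f g : ℤ → ℝ≥0∞, lowHighConv f g k = ∑' l : ℤ, if |l| ≤ |k - l| then
      ENNReal.ofReal (sobWeight (-(1 / 4)) (k - l)) * f (k - l) * g l else 0 := by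
    intro f g
    rw [lowHighConv, ← (Equiv.subLeft k).tsum_eq]
    simp
  rw [hflip (fun l => ENNReal.ofReal (sobWeight (s + 1 / 4) l) * ‖b l‖ₑ), lowHighConv,
    ← ENNReal.tsum_add, ← ENNReal.tsum_mul_left]
  calc _ ≤ ENNReal.ofReal (sobWeight s k) * ∑' l : ℤ, _ :=
        mul_le_mul_right enorm_tsum_le_tsum_enorm _
    _ = _ := ENNReal.tsum_mul_left.symm
    _ ≤ _ := ENNReal.tsum_le_tsum fun l => ?_
  rcases le_total |k - l| |l| with h | h
  · have := weighted_commutator_term_le h0 h1 hs h (a l) (b (k - l))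
    rw [add_sub_cancel] at this
    rw [if_pos h]
    exact this.trans (mul_le_mul_right le_self_add _)
  · have := weighted_commutator_term_le h0 h1 hs h (b (k - l)) (a l)
    rw [sub_add_cancel, mul_comm (b (k - l)), add_comm (|((k - l : ℤ) : ℝ)| ^ α)] at this
    rw [if_pos h]
    exact this.trans (mul_le_mul_right le_add_self _)

lemma sobEnergy_commutatorCoeff_le {α : ℝ} (h0 : 0 < α) (h1 : α < 1) {s : ℝ} (hs : 0 ≤ s)
    (a : ℤ → ℂ) :
    sobEnergy s (commutatorCoeff α a fun k => starRingEnd ℂ (a (-k))) ≤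
      ENNReal.ofReal (48 * 4 ^ s) * (sobEnergy (s + 1 / 2) a * sobEnergy α a) := by
  set b : ℤ → ℂ := fun k => starRingEnd ℂ (a (-k)) with hb
  have hsq (x y : ℝ≥0∞) : (x + y) ^ 2 ≤ 2 * (x ^ 2 + y ^ 2) := by
    have := ENNReal.rpow_add_le_mul_rpow_add_rpow x y (p := 2) (by norm_num)
    norm_num at this
    exact_mod_cast this
  have hE (r : ℝ) : sobEnergy r b = sobEnergy r a := sobEnergy_conj_neg r a
  have hT (c d : ℤ → ℂ) := tsum_lowHighConv_sq_le
    (fun l => ENNReal.ofReal (sobWeight (s / 2 + 1 / 4) l) * ‖c l‖ₑ)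
    (fun p => ENNReal.ofReal (sobWeight (α / 2) p) * ‖d p‖ₑ)
  have hs' : s / 2 + 1 / 4 = (s + 1 / 2) / 2 := by ring
  simp only [hs', ← sobEnergy_eq_tsum_sq] at hT
  have hC : ENNReal.ofReal (48 * 4 ^ s) = ENNReal.ofReal (2 * 4 ^ (s / 2)) ^ 2 * (2 * (3 + 3)) := by
    rw [← ENNReal.ofReal_pow (by positivity),
      show (2 * (3 + 3) : ℝ≥0∞) = ENNReal.ofReal 12 by norm_num,
      ← ENNReal.ofReal_mul (by positivity), mul_pow, ← Real.rpow_mul_natCast (by norm_num)]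
    congr 1
    push_cast
    rw [div_mul_cancel₀ _ two_ne_zero]
    ring
  rw [hC, sobEnergy_eq_tsum_sq]
  have hk (k : ℤ) := (pow_le_pow_left'
    (weighted_commutatorCoeff_le h0 h1 (s := s / 2) (by positivity) a b k) 2).trans_eq
      (mul_pow _ _ _) |>.trans (mul_le_mul_right (hsq _ _) _)
  simp only [hs'] at hk
  calc _ ≤ _ := ENNReal.tsum_le_tsum hk
    _ ≤ ENNReal.ofReal (2 * 4 ^ (s / 2)) ^ 2 *
          (2 * (3 * sobEnergy (s + 1 / 2) a * sobEnergy α b +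
            3 * sobEnergy (s + 1 / 2) b * sobEnergy α a)) := by
        rw [ENNReal.tsum_mul_left, ENNReal.tsum_mul_left, ENNReal.tsum_add]
        gcongr
        · exact hT a b
        · exact hT b a
    _ = _ := by
        rw [hE, hE]
        ring

end CommutatorSequence

section FourierSeries

/-- The sum of the Fourier series with coefficients `c`. -/
def fourierSeries (c : ℤ → ℂ) (x : Torus) : ℂ := ∑' k : ℤ, c k * fourier k x

lemma norm_mul_fourier (z : ℂ) (k : ℤ) (x : Torus) : ‖z * fourier k x‖ = ‖z‖ := by
  rw [norm_mul, fourier_apply, Circle.norm_coe, mul_one]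

lemma fourierCoeff_fourierSeries {c : ℤ → ℂ} (hc : Summable fun k => ‖c k‖) :
    fourierCoeff (fourierSeries c) = c := by
  ext j
  have hmul (k : ℤ) (t : Torus) :
      fourier (-j) t • (c k * fourier k t) = c k • (fourier (-j) t • fourier k t) := by
    simp only [smul_eq_mul]; ring
  have hcont (k : ℤ) : Continuous fun t : Torus => fourier (-j) t • (c k * fourier k t) := by
    fun_prop
  have hint (k : ℤ) :
      ∫ t : Torus, fourier (-j) t • (c k * fourier k t) ∂AddCircle.haarAddCircle =
        c k * (Pi.single k 1 : ℤ → ℂ) j := by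
    simp only [hmul]
    rw [integral_smul, smul_eq_mul, ← fourierCoeff_fourier (T := 2 * π) k]
    rfl
  have hs : Summable fun k : ℤ =>
      ∫ t : Torus, ‖fourier (-j) t • (c k * fourier k t)‖ ∂AddCircle.haarAddCircle := by
    refine hc.congr fun k => ?_
    have (t : Torus) : ‖fourier (-j) t • (c k * fourier k t)‖ = ‖c k‖ := by
      rw [smul_eq_mul, mul_comm, norm_mul_fourier, norm_mul_fourier]
    simp only [this, integral_const, probReal_univ, one_smul]
  have h := hasSum_integral_of_summable_integral_norm
    (fun k => (hcont k).integrable_of_hasCompactSupport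
      (HasCompactSupport.of_compactSpace _)) hs
  have e (t : Torus) : ∑' k : ℤ, fourier (-j) t • (c k * fourier k t) =
      fourier (-j) t • fourierSeries c t := tsum_const_smul'' _
  simp only [hint, e] at h
  rw [fourierCoeff, ← h.tsum_eq, tsum_eq_single j]
  · simp
  · intro k hk
    simp [hk.symm]

lemma fourierCoeff_conj (u : Torus → ℂ) (k : ℤ) :
    fourierCoeff (fun y => starRingEnd ℂ (u y)) k = starRingEnd ℂ (fourierCoeff u (-k)) := by
  rw [fourierCoeff, fourierCoeff, ← integral_conj]
  refine integral_congr_ae (ae_of_all _ fun t => ?_)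
  simp only [smul_eq_mul, map_mul, neg_neg, fourier_neg]

/-- Reindexing of pairs of frequencies by their sum and their first entry. -/
def freqSumEquiv : ℤ × ℤ ≃ ℤ × ℤ where
  toFun q := (q.2, q.1 - q.2)
  invFun q := (q.1 + q.2, q.1)
  left_inv q := by ext <;> simp
  right_inv q := by ext <;> simp

lemma summable_norm_diagonal_tsum {Φ : ℤ × ℤ → ℂ} (h : Summable fun q => ‖Φ q‖) :
    Summable fun k : ℤ => ‖∑' l : ℤ, Φ (l, k - l)‖ := by
  have h' : Summable fun q : ℤ × ℤ => ‖Φ (q.2, q.1 - q.2)‖ := freqSumEquiv.summable_iff.mpr h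
  exact h'.prod.of_nonneg_of_le (fun _ => norm_nonneg _)
    fun k => norm_tsum_le_tsum_norm (h'.prod_factor k)

lemma fourierSeries_diagonal_tsum {Φ : ℤ × ℤ → ℂ} (h : Summable fun q => ‖Φ q‖) (x : Torus) :
    fourierSeries (fun k => ∑' l : ℤ, Φ (l, k - l)) x =
      ∑' q : ℤ × ℤ, Φ q * fourier (q.1 + q.2) x := by
  have h' : Summable fun q : ℤ × ℤ => Φ q * fourier (q.1 + q.2) x :=
    .of_norm (h.congr fun q => (norm_mul_fourier _ _ _).symm)
  rw [← freqSumEquiv.tsum_eq (fun q => Φ q * fourier (q.1 + q.2) x)]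
  refine Eq.trans ?_ (freqSumEquiv.summable_iff.mpr h').tsum_prod.symm
  refine tsum_congr fun k => ?_
  simp [freqSumEquiv, -fourier_apply, tsum_mul_right]

lemma fourierSeries_mul {c d : ℤ → ℂ} (hc : Summable fun k => ‖c k‖)
    (hd : Summable fun k => ‖d k‖) (x : Torus) :
    fourierSeries c x * fourierSeries d x =
      ∑' q : ℤ × ℤ, c q.1 * d q.2 * fourier (q.1 + q.2) x := by
  rw [fourierSeries, fourierSeries, tsum_mul_tsum_of_summable_norm
    (hc.congr fun k => (norm_mul_fourier _ _ _).symm)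
    (hd.congr fun k => (norm_mul_fourier _ _ _).symm)]
  refine tsum_congr fun q => ?_
  rw [fourier_add]
  ring

lemma eq_fourierSeries {u : Torus → ℂ} (hu : Continuous u)
    (h : Summable fun k => ‖fourierCoeff u k‖) : u = fourierSeries (fourierCoeff u) := by
  ext x
  exact (has_pointwise_sum_fourier_series_of_summable (f := ⟨u, hu⟩) h.of_norm x).tsum_eq.symm

lemma fourierCoeff_mul {u v : Torus → ℂ} (hu : Continuous u) (hv : Continuous v)
    (hus : Summable fun k => ‖fourierCoeff u k‖) (hvs : Summable fun k => ‖fourierCoeff v k‖) :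
    fourierCoeff (fun y => v y * u y) =
      fun k => ∑' l : ℤ, fourierCoeff u l * fourierCoeff v (k - l) := by
  have h : Summable fun q : ℤ × ℤ => ‖fourierCoeff u q.1 * fourierCoeff v q.2‖ := hus.mul_norm hvs
  have e : (fun y => v y * u y) =
      fourierSeries fun k => ∑' l : ℤ, fourierCoeff u l * fourierCoeff v (k - l) := by
    ext y
    rw [fourierSeries_diagonal_tsum (Φ := fun q => fourierCoeff u q.1 * fourierCoeff v q.2) h,
      ← fourierSeries_mul hus hvs, ← eq_fourierSeries hu hus, ← eq_fourierSeries hv hvs, mul_comm]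
  rw [e]
  exact fourierCoeff_fourierSeries (summable_norm_diagonal_tsum
    (Φ := fun q => fourierCoeff u q.1 * fourierCoeff v q.2) h)

lemma fracD_eq_fourierSeries (ρ : ℝ) (w : Torus → ℂ) :
    fracD ρ w = fourierSeries fun k => ((|(k : ℝ)| ^ ρ : ℝ) : ℂ) * fourierCoeff w k := rfl

lemma summable_norm_symbol_mul {α : ℝ} (h0 : 0 < α) (h1 : α < 1) {a b : ℤ → ℂ}
    (s1 : Summable fun q : ℤ × ℤ => ‖((|(q.1 : ℝ)| ^ α : ℝ) : ℂ) * a q.1 * b q.2‖)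
    (s2 : Summable fun q : ℤ × ℤ => ‖a q.1 * (((|(q.2 : ℝ)| ^ α : ℝ) : ℂ) * b q.2)‖) :
    Summable fun q : ℤ × ℤ =>
      ‖((|((q.1 + q.2 : ℤ) : ℝ)| ^ α : ℝ) : ℂ) * (a q.1 * b q.2)‖ := by
  refine (s1.add s2).of_nonneg_of_le (fun _ => norm_nonneg _) fun q => ?_
  simp only [norm_mul, Complex.norm_real]
  rw [Real.norm_of_nonneg (by positivity), Real.norm_of_nonneg (by positivity),
    Real.norm_of_nonneg (by positivity)]
  have : |((q.1 + q.2 : ℤ) : ℝ)| ^ α ≤ |(q.1 : ℝ)| ^ α + |(q.2 : ℝ)| ^ α := by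
    push_cast
    exact (Real.rpow_le_rpow (abs_nonneg _) (abs_add_le _ _) h0.le).trans
      (Real.rpow_add_le_add_rpow (abs_nonneg _) (abs_nonneg _) h0.le h1.le)
  calc _ ≤ (|(q.1 : ℝ)| ^ α + |(q.2 : ℝ)| ^ α) * (‖a q.1‖ * ‖b q.2‖) :=
        mul_le_mul_of_nonneg_right this (by positivity)
    _ = _ := by ring

lemma summable_norm_of_sobWeight {α : ℝ} (h0 : 0 < α) {c : ℤ → ℂ}
    (hc : Summable fun k => sobWeight (α / 2) k * ‖c k‖) : Summable fun k => ‖c k‖ :=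
  hc.of_nonneg_of_le (fun _ => norm_nonneg _) fun k =>
    le_mul_of_one_le_left (norm_nonneg _) (one_le_sobWeight (by positivity) k)

lemma summable_norm_abs_rpow_mul {α : ℝ} (h0 : 0 < α) {c : ℤ → ℂ}
    (hc : Summable fun k => sobWeight (α / 2) k * ‖c k‖) :
    Summable fun k : ℤ => ‖((|(k : ℝ)| ^ α : ℝ) : ℂ) * c k‖ := by
  refine hc.of_nonneg_of_le (fun _ => norm_nonneg _) fun k => ?_
  rw [norm_mul, Complex.norm_real, Real.norm_of_nonneg (by positivity)]
  exact mul_le_mul_of_nonneg_right (abs_rpow_le_sobWeight h0.le k) (norm_nonneg _)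

/-- The symbol of the commutator, applied to a pair of frequencies. -/
def commutatorTerm (α : ℝ) (a b : ℤ → ℂ) (q : ℤ × ℤ) : ℂ :=
  ((|(q.1 : ℝ)| ^ α + |(q.2 : ℝ)| ^ α - |((q.1 + q.2 : ℤ) : ℝ)| ^ α : ℝ) : ℂ) * (a q.1 * b q.2)

lemma commutatorTerm_eq (α : ℝ) (a b : ℤ → ℂ) (q : ℤ × ℤ) :
    commutatorTerm α a b q = ((|(q.1 : ℝ)| ^ α : ℝ) : ℂ) * a q.1 * b q.2 +
      a q.1 * (((|(q.2 : ℝ)| ^ α : ℝ) : ℂ) * b q.2) -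
      ((|((q.1 + q.2 : ℤ) : ℝ)| ^ α : ℝ) : ℂ) * (a q.1 * b q.2) := by
  simp only [commutatorTerm, Complex.ofReal_sub, Complex.ofReal_add]
  ring

lemma commutatorCoeff_eq (α : ℝ) (a b : ℤ → ℂ) :
    commutatorCoeff α a b = fun k => ∑' l : ℤ, commutatorTerm α a b (l, k - l) := by
  ext k
  simp only [commutatorCoeff, commutatorTerm, add_sub_cancel]

lemma summable_norm_commutatorTerm {α : ℝ} (h0 : 0 < α) (h1 : α < 1) {a b : ℤ → ℂ}
    (s1 : Summable fun q : ℤ × ℤ => ‖((|(q.1 : ℝ)| ^ α : ℝ) : ℂ) * a q.1 * b q.2‖)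
    (s2 : Summable fun q : ℤ × ℤ => ‖a q.1 * (((|(q.2 : ℝ)| ^ α : ℝ) : ℂ) * b q.2)‖) :
    Summable fun q => ‖commutatorTerm α a b q‖ := by
  refine ((s1.add s2).add (summable_norm_symbol_mul (a := a) (b := b) h0 h1 s1 s2)).of_nonneg_of_le
    (fun _ => norm_nonneg _) fun q => ?_
  rw [commutatorTerm_eq]
  exact (norm_sub_le _ _).trans (add_le_add_left (norm_add_le _ _) _)

lemma fourierSeries_commutatorCoeff {α : ℝ} (h0 : 0 < α) (h1 : α < 1) {a b : ℤ → ℂ}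
    (ha : Summable fun k => ‖a k‖) (hb : Summable fun k => ‖b k‖)
    (haα : Summable fun k : ℤ => ‖((|(k : ℝ)| ^ α : ℝ) : ℂ) * a k‖)
    (hbα : Summable fun k : ℤ => ‖((|(k : ℝ)| ^ α : ℝ) : ℂ) * b k‖) (x : Torus) :
    fourierSeries b x * fourierSeries (fun k => ((|(k : ℝ)| ^ α : ℝ) : ℂ) * a k) x +
        fourierSeries a x * fourierSeries (fun k => ((|(k : ℝ)| ^ α : ℝ) : ℂ) * b k) x -
        fourierSeries (fun k => ((|(k : ℝ)| ^ α : ℝ) : ℂ) * ∑' l : ℤ, a l * b (k - l)) x =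
      fourierSeries (commutatorCoeff α a b) x := by
  have s1 : Summable fun q : ℤ × ℤ => ‖((|(q.1 : ℝ)| ^ α : ℝ) : ℂ) * a q.1 * b q.2‖ :=
    (haα.mul_norm hb :)
  have s2 : Summable fun q : ℤ × ℤ => ‖a q.1 * (((|(q.2 : ℝ)| ^ α : ℝ) : ℂ) * b q.2)‖ :=
    (ha.mul_norm hbα :)
  have s3 := summable_norm_symbol_mul (a := a) (b := b) h0 h1 s1 s2
  have e3 := fourierSeries_diagonal_tsum
    (Φ := fun q => ((|((q.1 + q.2 : ℤ) : ℝ)| ^ α : ℝ) : ℂ) * (a q.1 * b q.2)) s3 x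
  simp only [add_sub_cancel, tsum_mul_left] at e3
  have toSum {Ψ : ℤ × ℤ → ℂ} (h : Summable fun q => ‖Ψ q‖) :
      Summable fun q : ℤ × ℤ => Ψ q * fourier (q.1 + q.2) x :=
    .of_norm (h.congr fun q => (norm_mul_fourier _ _ _).symm)
  rw [mul_comm (fourierSeries b x), fourierSeries_mul haα hb, fourierSeries_mul ha hbα, e3,
    ← (toSum s1).tsum_add (toSum s2), ← ((toSum s1).add (toSum s2)).tsum_sub (toSum s3),
    commutatorCoeff_eq, fourierSeries_diagonal_tsum (Φ := commutatorTerm α a b)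
      (summable_norm_commutatorTerm (a := a) (b := b) h0 h1 s1 s2)]
  refine tsum_congr fun q => ?_
  rw [commutatorTerm_eq]
  ring

lemma summable_norm_commutatorCoeff {α : ℝ} (h0 : 0 < α) (h1 : α < 1) {a b : ℤ → ℂ}
    (ha : Summable fun k => ‖a k‖) (hb : Summable fun k => ‖b k‖)
    (haα : Summable fun k : ℤ => ‖((|(k : ℝ)| ^ α : ℝ) : ℂ) * a k‖)
    (hbα : Summable fun k : ℤ => ‖((|(k : ℝ)| ^ α : ℝ) : ℂ) * b k‖) :
    Summable fun k => ‖commutatorCoeff α a b k‖ := by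
  rw [commutatorCoeff_eq]
  exact summable_norm_diagonal_tsum (Φ := commutatorTerm α a b)
    (summable_norm_commutatorTerm (a := a) (b := b) h0 h1
      (haα.mul_norm hb :) (ha.mul_norm hbα :))

lemma fourierCoeff_commutator {α : ℝ} (h0 : 0 < α) (h1 : α < 1) {u v : Torus → ℂ}
    (hu : Continuous u) (hv : Continuous v)
    (hus : Summable fun k => sobWeight (α / 2) k * ‖fourierCoeff u k‖)
    (hvs : Summable fun k => sobWeight (α / 2) k * ‖fourierCoeff v k‖) :
    fourierCoeff (fun x => v x * fracD α u x + u x * fracD α v x - fracD α (fun y => v y * u y) x) =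
      commutatorCoeff α (fourierCoeff u) (fourierCoeff v) := by
  have ha := summable_norm_of_sobWeight h0 hus
  have hb := summable_norm_of_sobWeight h0 hvs
  have haα := summable_norm_abs_rpow_mul h0 hus
  have hbα := summable_norm_abs_rpow_mul h0 hvs
  rw [← fourierCoeff_fourierSeries (summable_norm_commutatorCoeff h0 h1 ha hb haα hbα)]
  refine congrArg fourierCoeff (funext fun x => ?_)
  rw [← fourierSeries_commutatorCoeff h0 h1 ha hb haα hbα, ← eq_fourierSeries hu ha,
    ← eq_fourierSeries hv hb, fracD_eq_fourierSeries, fracD_eq_fourierSeries,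
    fracD_eq_fourierSeries, fourierCoeff_mul hu hv ha hb]

lemma summable_sobWeight_mul_norm {α s : ℝ} (hs : 1 ≤ s) {a : ℤ → ℂ}
    (h : Summable fun k => sobWeight (α + s) k * ‖a k‖ ^ 2) :
    Summable fun k => sobWeight (α / 2) k * ‖a k‖ := by
  refine (h.add summable_sobWeight_neg_one).of_nonneg_of_le
    (fun k => mul_nonneg (sobWeight_pos _ _).le (norm_nonneg _)) fun k => ?_
  have e1 : sobWeight (α / 2) k = sobWeight ((α + s) / 2) k * sobWeight (-s / 2) k := by
    rw [sobWeight_mul]; congr 1; ring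
  have e2 : sobWeight (α + s) k = sobWeight ((α + s) / 2) k ^ 2 := by
    rw [sobWeight_sq]; congr 1; ring
  have e3 : sobWeight (-s / 2) k ^ 2 ≤ sobWeight (-1) k := by
    rw [sobWeight_sq]; exact sobWeight_mono (by linarith) k
  rw [e1, e2]
  nlinarith [two_mul_le_add_sq (sobWeight ((α + s) / 2) k * ‖a k‖) (sobWeight (-s / 2) k),
    sq_nonneg (sobWeight ((α + s) / 2) k * ‖a k‖), sq_nonneg (sobWeight (-s / 2) k)]

end FourierSeries

/-- Rough Leibniz lemma for `|D|^α`, `1/2 < α < 1`, with a constant independent of `α`. -/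
theorem rough_leibniz_lemma_fracD (n : ℕ) (hn : 1 ≤ n) :
    ∃ C > 0, ∀ α : ℝ, 1 / 2 < α → α < 1 → ∀ u : Torus → ℂ, Continuous u →
      Summable (fun k : ℤ => (1 + |(k : ℝ)| ^ 2) ^ (α + n) * ‖fourierCoeff u k‖ ^ 2) →
      sobNorm n
          (fun x =>
            starRingEnd ℂ (u x) * fracD α u x +
              u x * fracD α (fun y => starRingEnd ℂ (u y)) x -
              fracD α (fun y => starRingEnd ℂ (u y) * u y) x) ≤
        C * sobNorm α u ^ ((1 : ℝ) + (α - 1 / 2) / n) *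
          sobNorm (α + n) u ^ ((1 : ℝ) - (α - 1 / 2) / n) := by
  have hn' : (1 : ℝ) ≤ n := by exact_mod_cast hn
  have hC : (0 : ℝ) < 48 * 4 ^ (n : ℝ) := by positivity
  refine ⟨Real.sqrt (48 * 4 ^ (n : ℝ)), Real.sqrt_pos.mpr hC, fun α hα hα1 u hu hsum => ?_⟩
  have hα0 : 0 < α := by linarith
  set θ : ℝ := (α - 1 / 2) / n with hθ
  have hnθ : n * θ = α - 1 / 2 := by rw [hθ]; field_simp
  have hθ0 : 0 ≤ θ := by apply div_nonneg <;> linarith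
  have hθ1 : θ ≤ 1 := by rw [hθ, div_le_one (by linarith)]; linarith
  set a := fourierCoeff u with ha
  have hconj : fourierCoeff (fun y => starRingEnd ℂ (u y)) = fun k => starRingEnd ℂ (a (-k)) :=
    funext (fourierCoeff_conj u)
  have hus : Summable fun k => sobWeight (α / 2) k * ‖a k‖ :=
    summable_sobWeight_mul_norm hn' hsum
  have hvs : Summable fun k => sobWeight (α / 2) k *
      ‖fourierCoeff (fun y => starRingEnd ℂ (u y)) k‖ := by
    rw [hconj]
    refine ((Equiv.neg ℤ).summable_iff.mpr hus).congr fun k => ?_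
    simp [sobWeight_neg]
  have hbound := sobEnergy_commutatorCoeff_le hα0 hα1 (Nat.cast_nonneg n) a
  have hinterp := sobEnergy_interpolation (s := α) (t := α + n) hθ0 hθ1 a
  rw [show α * θ + (α + n) * (1 - θ) = n + 1 / 2 by linear_combination -hnθ] at hinterp
  have hY : sobEnergy (α + n) a ≠ ⊤ := sobEnergy_ne_top hsum
  have hX : sobEnergy α a ≠ ⊤ := ne_top_of_le_ne_top hY (sobEnergy_mono (by linarith) a)
  have hle := hbound.trans (mul_le_mul_right (mul_le_mul_left hinterp _) _)
  have hreal := ENNReal.toReal_mono (ENNReal.mul_ne_top ENNReal.ofReal_ne_top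
    (ENNReal.mul_ne_top (ENNReal.mul_ne_top (ENNReal.rpow_ne_top_of_nonneg hθ0 hX)
      (ENNReal.rpow_ne_top_of_nonneg (sub_nonneg.mpr hθ1) hY)) hX)) hle
  simp only [ENNReal.toReal_mul, ← ENNReal.toReal_rpow, ENNReal.toReal_ofReal hC.le] at hreal
  rw [sobNorm_eq, sobNorm_eq, sobNorm_eq, fourierCoeff_commutator hα0 hα1 hu
    (v := fun y => starRingEnd ℂ (u y)) (Complex.continuous_conj.comp hu) hus hvs, hconj]
  refine Real.sqrt_le_iff.mpr ⟨by positivity, hreal.trans_eq ?_⟩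
  rw [mul_pow, mul_pow, Real.sq_sqrt hC.le, Real.rpow_pow_comm (Real.sqrt_nonneg _),
    Real.rpow_pow_comm (Real.sqrt_nonneg _), Real.sq_sqrt ENNReal.toReal_nonneg,
    Real.sq_sqrt ENNReal.toReal_nonneg,
    Real.rpow_add_of_nonneg ENNReal.toReal_nonneg zero_le_one hθ0, Real.rpow_one]
  ring

end
end

section
/- (Brezis–Gallouët inequality on $\mathbb{T}$.) For every $s > 1/2$ there is $C_s > 0$ such that for all $w \in H^s(\mathbb{T})$ with $w \neq 0$, $\|w\|_{L^\infty} \leq C_s \|w\|_{H^{1/2}} \big[\log\big(1 + \|w\|_{H^s}/\|w\|_{H^{1/2}}\big)\big]^{1/2}$. -/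
open Real Complex MeasureTheory

noncomputable section

lemma mul_rpow_neg_one_sub_le {e m : ℝ} (he : 0 < e) (hm : 0 < m) :
    e * (m + 1) ^ (-1 - e) ≤ m ^ (-e) - (m + 1) ^ (-e) := by
  have hm1 : 0 < m + 1 := by linarith
  have hq : 0 < m / (m + 1) := by positivity
  have h1 : 1 + e / (m + 1) ≤ (m / (m + 1)) ^ (-e) := by
    rw [Real.rpow_def_of_pos hq]
    have hl := Real.log_le_sub_one_of_pos hq
    have h2 : m / (m + 1) - 1 = -(1 / (m + 1)) := by field_simp; ring
    rw [h2] at hl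
    have h3 : e / (m + 1) = e * (1 / (m + 1)) := by ring
    have h4 := Real.add_one_le_exp (Real.log (m / (m + 1)) * -e)
    nlinarith
  have h5 : m ^ (-e) = (m + 1) ^ (-e) * (m / (m + 1)) ^ (-e) := by
    rw [← Real.mul_rpow hm1.le hq.le]
    congr 1
    field_simp
  have h6 : (m + 1) ^ (-1 - e) = (m + 1) ^ (-e) / (m + 1) := by
    rw [← Real.rpow_sub_one hm1.ne']
    congr 1
    ring
  have h7 : 0 < (m + 1) ^ (-e) := Real.rpow_pos_of_pos hm1 _
  have h8 := mul_le_mul_of_nonneg_left h1 h7.le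
  rw [h5, h6]
  have h9 : e * ((m + 1) ^ (-e) / (m + 1)) = (m + 1) ^ (-e) * (e / (m + 1)) := by ring
  rw [h9]
  linarith

lemma sum_range_rpow_le {e : ℝ} (he : 0 < e) (N : ℕ) :
    ∑ n ∈ Finset.range N, ((n : ℝ) + 1) ^ (-1 - e) ≤ 1 + 1 / e := by
  have key : ∀ N : ℕ, ∑ n ∈ Finset.range (N + 1), ((n : ℝ) + 1) ^ (-1 - e) ≤
      1 + 1 / e - 1 / e * ((N : ℝ) + 1) ^ (-e) := by
    intro N
    induction N with
    | zero => simp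
    | succ N ih =>
      rw [Finset.sum_range_succ]
      have h := mul_rpow_neg_one_sub_le he (m := (N : ℝ) + 1) (by positivity)
      have h' := mul_le_mul_of_nonneg_left h (one_div_pos.2 he).le
      rw [← mul_assoc, one_div_mul_cancel he.ne', one_mul] at h'
      push_cast
      linarith
  cases N with
  | zero => simp; positivity
  | succ N =>
    have : 0 ≤ 1 / e * ((N : ℝ) + 1) ^ (-e) := by positivity
    linarith [key N]

lemma summable_and_tsum_rpow_le {e : ℝ} (he : 0 < e) :
    Summable (fun n : ℕ => ((n : ℝ) + 1) ^ (-1 - e)) ∧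
      ∑' n : ℕ, ((n : ℝ) + 1) ^ (-1 - e) ≤ 1 + 1 / e :=
  ⟨summable_of_sum_range_le (fun _ => by positivity) (sum_range_rpow_le he),
    Real.tsum_le_of_sum_range_le (fun _ => by positivity) (sum_range_rpow_le he)⟩

lemma japanese_rpow_neg_le {t x y : ℝ} (ht : 0 ≤ t) (hy : 0 < y)
    (h : y ^ 2 ≤ 2 * (1 + x ^ 2)) :
    (1 + x ^ 2) ^ (-t) ≤ 2 ^ t * y ^ (-(2 * t)) := by
  have h1 : y ^ 2 / 2 ≤ 1 + x ^ 2 := by linarith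
  refine (Real.rpow_le_rpow_of_nonpos (by positivity) h1 (by linarith)).trans_eq ?_
  rw [Real.div_rpow (by positivity) (by norm_num), Real.rpow_neg (by norm_num : (0 : ℝ) ≤ 2),
    div_inv_eq_mul, ← Real.rpow_natCast, ← Real.rpow_mul hy.le, mul_comm]
  congr 2
  push_cast
  ring

lemma summable_and_tsum_japanese_le {t : ℝ} (ht : 1 / 2 < t) :
    Summable (fun k : ℤ => (1 + |(k : ℝ)| ^ 2) ^ (-t)) ∧
      ∑' k : ℤ, (1 + |(k : ℝ)| ^ 2) ^ (-t) ≤ 2 * 2 ^ t * (1 + 1 / (2 * t - 1)) := by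
  obtain ⟨hS, hT⟩ := summable_and_tsum_rpow_le (e := 2 * t - 1) (by linarith)
  have he : -1 - (2 * t - 1) = -(2 * t) := by ring
  simp only [he] at hS hT
  have hS' := hS.mul_left ((2 : ℝ) ^ t)
  have h1 : ∀ n : ℕ, (1 + |((n : ℤ) : ℝ)| ^ 2) ^ (-t) ≤ 2 ^ t * ((n : ℝ) + 1) ^ (-(2 * t)) := by
    intro n
    refine japanese_rpow_neg_le (by linarith) (by positivity) ?_
    rw [sq_abs]
    push_cast
    nlinarith [sq_nonneg ((n : ℝ) - 1)]
  have h2 : ∀ n : ℕ, (1 + |((-((n : ℤ) + 1) : ℤ) : ℝ)| ^ 2) ^ (-t) ≤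
      2 ^ t * ((n : ℝ) + 1) ^ (-(2 * t)) := by
    intro n
    refine japanese_rpow_neg_le (by linarith) (by positivity) ?_
    rw [sq_abs]
    push_cast
    nlinarith [sq_nonneg ((n : ℝ) + 1)]
  have s1 := Summable.of_nonneg_of_le (fun _ => by positivity) h1 hS'
  have s2 := Summable.of_nonneg_of_le (fun _ => by positivity) h2 hS'
  have hs := HasSum.of_nat_of_neg_add_one (f := fun k : ℤ => (1 + |(k : ℝ)| ^ 2) ^ (-t))
    s1.hasSum s2.hasSum
  refine ⟨hs.summable, ?_⟩
  rw [hs.tsum_eq]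
  have t1 := s1.tsum_le_tsum h1 hS'
  have t2 := s2.tsum_le_tsum h2 hS'
  rw [tsum_mul_left] at t1 t2
  have := mul_le_mul_of_nonneg_left hT (by positivity : (0 : ℝ) ≤ 2 ^ t)
  linarith

/-- Cauchy–Schwarz for series, against a positive weight. -/
lemma summable_and_sq_tsum_le {ι : Type*} {a l : ι → ℝ} {M K : ℝ} (ha : ∀ k, 0 ≤ a k)
    (hl : ∀ k, 0 < l k) (hf : Summable fun k => l k * a k ^ 2)
    (hM : ∑' k, l k * a k ^ 2 ≤ M) (hg : Summable fun k => (l k)⁻¹)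
    (hK : ∑' k, (l k)⁻¹ ≤ K) :
    Summable a ∧ ∑' k, a k ≤ √(M * K) := by
  have hfn : ∀ k, 0 ≤ l k * a k ^ 2 := fun k => mul_nonneg (hl k).le (sq_nonneg _)
  have hgn : ∀ k, 0 ≤ (l k)⁻¹ := fun k => (inv_pos.2 (hl k)).le
  have key : ∀ F : Finset ι, ∑ k ∈ F, a k ≤ √(M * K) := by
    intro F
    refine Real.le_sqrt_of_sq_le ?_
    refine (Finset.sum_sq_le_sum_mul_sum_of_sq_le_mul F (fun k _ => hfn k) (fun k _ => hgn k)
      (fun k _ => ?_)).trans ?_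
    · rw [mul_right_comm, mul_inv_cancel₀ (hl k).ne', one_mul]
    · exact mul_le_mul ((hf.sum_le_tsum F fun k _ => hfn k).trans hM)
        ((hg.sum_le_tsum F fun k _ => hgn k).trans hK) (Finset.sum_nonneg fun k _ => hgn k)
        ((tsum_nonneg hfn).trans hM)
  exact ⟨summable_of_sum_le ha key, Real.tsum_le_of_sum_le ha key⟩

/-- Interpolation between the weights `l ^ (1/2)` and `l ^ s`, with a free parameter `R`. -/
lemma rpow_interpolate_le {l R s θ : ℝ} (hl : 0 < l) (hR : 0 < R) (h0 : 0 ≤ θ) (h1 : θ ≤ 1) :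
    l ^ (1 / 2 + (s - 1 / 2) * θ) ≤
      (R ^ 2) ^ θ * (l ^ (1 / 2 : ℝ) + l ^ s / R ^ 2) := by
  have hA : 0 < l ^ (1 / 2 : ℝ) := by positivity
  have hB : 0 < l ^ s / R ^ 2 := by positivity
  have h := Real.geom_mean_le_arith_mean2_weighted (sub_nonneg.2 h1) h0 hA.le hB.le (by ring)
  have h2 : l ^ (1 / 2 + (s - 1 / 2) * θ) =
      (R ^ 2) ^ θ * ((l ^ (1 / 2 : ℝ)) ^ (1 - θ) * (l ^ s / R ^ 2) ^ θ) := by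
    rw [Real.div_rpow (by positivity) (by positivity), ← Real.rpow_mul hl.le,
      ← Real.rpow_mul hl.le]
    have : (R ^ 2) ^ θ ≠ 0 := by positivity
    field_simp
    rw [← Real.rpow_add hl]
    congr 1
    ring
  rw [h2]
  refine mul_le_mul_of_nonneg_left (h.trans ?_) (by positivity)
  nlinarith

lemma norm_le_tsum_norm_fourierCoeff {w : Torus → ℂ} (hw : Continuous w)
    (h : Summable fun k => ‖fourierCoeff w k‖) (x : Torus) :
    ‖w x‖ ≤ ∑' k, ‖fourierCoeff w k‖ := by
  have hs : HasSum (fun k => fourierCoeff w k • fourier k x) (w x) :=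
    has_pointwise_sum_fourier_series_of_summable (f := ⟨w, hw⟩) h.of_norm x
  have hn : ∀ k : ℤ, ‖fourierCoeff w k • fourier k x‖ = ‖fourierCoeff w k‖ := by
    intro k
    rw [norm_smul, fourier_apply, Circle.norm_coe, mul_one]
  have := tsum_of_norm_bounded h.hasSum fun k => (hn k).le
  rwa [← hs.tsum_eq]

/-- Brezis–Gallouët inequality on the torus. -/
theorem brezis_gallouet (s : ℝ) (hs : 1 / 2 < s) :
    ∃ C > 0, ∀ w : Torus → ℂ, Continuous w →
      Summable (fun k : ℤ => (1 + |(k : ℝ)| ^ 2) ^ s * ‖fourierCoeff w k‖ ^ 2) →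
      w ≠ 0 →
      ∀ x : Torus,
        ‖w x‖ ≤
          C * sobNorm (1 / 2) w *
            Real.sqrt (Real.log (1 + sobNorm s w / sobNorm (1 / 2) w)) := by
  have hs0 : 0 < 2 * s - 1 := by linarith
  have hlog2 : 0 < Real.log 2 := Real.log_pos (by norm_num)
  set D : ℝ := 8 * (2 * 2 ^ s * ((1 + 1 / (2 * s - 1)) / Real.log 2)) with hD
  have hDpos : 0 < D := by positivity
  refine ⟨√D, Real.sqrt_pos.2 hDpos, fun w hw hsum _ x => ?_⟩
  have hl1 : ∀ k : ℤ, 1 ≤ 1 + |(k : ℝ)| ^ 2 := fun k => by linarith [sq_nonneg |(k : ℝ)|]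
  have hl0 : ∀ k : ℤ, 0 < 1 + |(k : ℝ)| ^ 2 := fun k => by positivity
  have hle : ∀ k : ℤ, (1 + |(k : ℝ)| ^ 2) ^ (1 / 2 : ℝ) * ‖fourierCoeff w k‖ ^ 2 ≤
      (1 + |(k : ℝ)| ^ 2) ^ s * ‖fourierCoeff w k‖ ^ 2 := fun k =>
    mul_le_mul_of_nonneg_right (Real.rpow_le_rpow_of_exponent_le (hl1 k) hs.le) (sq_nonneg _)
  have hhalf : Summable fun k : ℤ =>
      (1 + |(k : ℝ)| ^ 2) ^ (1 / 2 : ℝ) * ‖fourierCoeff w k‖ ^ 2 :=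
    Summable.of_nonneg_of_le (fun _ => by positivity) hle hsum
  have hA2 : sobNorm (1 / 2) w ^ 2 = ∑' k : ℤ,
      (1 + |(k : ℝ)| ^ 2) ^ (1 / 2 : ℝ) * ‖fourierCoeff w k‖ ^ 2 :=
    Real.sq_sqrt (tsum_nonneg fun _ => by positivity)
  have hB2 : sobNorm s w ^ 2 = ∑' k : ℤ,
      (1 + |(k : ℝ)| ^ 2) ^ s * ‖fourierCoeff w k‖ ^ 2 :=
    Real.sq_sqrt (tsum_nonneg fun _ => by positivity)
  have hAB : sobNorm (1 / 2) w ≤ sobNorm s w :=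
    Real.sqrt_le_sqrt (hhalf.tsum_le_tsum hle hsum)
  have hA0 : 0 ≤ sobNorm (1 / 2) w := Real.sqrt_nonneg _
  generalize sobNorm (1 / 2) w = A at *
  generalize sobNorm s w = B at *
  rcases hA0.eq_or_lt with rfl | hA
  · have hz : ∀ k, ‖fourierCoeff w k‖ = 0 := by
      intro k
      have h1 := hhalf.le_tsum k fun _ _ => by positivity
      rw [← hA2] at h1
      have h2 : 0 < (1 + |(k : ℝ)| ^ 2) ^ (1 / 2 : ℝ) := Real.rpow_pos_of_pos (hl0 k) _
      by_contra hne
      have : 0 < ‖fourierCoeff w k‖ ^ 2 := by positivity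
      nlinarith [mul_pos h2 this]
    have := norm_le_tsum_norm_fourierCoeff hw (by simp only [hz]; exact summable_zero) x
    simpa [hz] using this
  set R := B / A with hRdef
  have hR1 : 1 ≤ R := (one_le_div hA).2 hAB
  have hR : 0 < R := by linarith
  set L := Real.log (1 + R) with hL
  have hL2 : Real.log 2 ≤ L := Real.log_le_log (by norm_num) (by linarith)
  have hLpos : 0 < L := hlog2.trans_le hL2
  set θ := Real.log 2 / L with hθ
  have hθ0 : 0 < θ := by positivity
  have hθ1 : θ ≤ 1 := (div_le_one hLpos).2 hL2
  have hRθ : (R ^ 2) ^ θ ≤ 4 := by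
    have h1 : (1 + R) ^ θ = 2 := by
      rw [Real.rpow_def_of_pos (by linarith), ← hL, hθ, mul_div_cancel₀ _ hLpos.ne',
        Real.exp_log (by norm_num)]
    have h2 : R ^ θ ≤ 2 := h1 ▸ Real.rpow_le_rpow hR.le (by linarith) hθ0.le
    have h3 : (R ^ 2) ^ θ = R ^ θ * R ^ θ := by
      rw [sq, Real.mul_rpow hR.le hR.le]
    have h4 : 0 < R ^ θ := Real.rpow_pos_of_pos hR _
    rw [h3]
    nlinarith
  set t := 1 / 2 + (s - 1 / 2) * θ with ht
  have ht1 : 1 / 2 < t := by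
    have : 0 < (s - 1 / 2) * θ := mul_pos (by linarith) hθ0
    linarith
  have hts : t ≤ s := by nlinarith
  have hterm : ∀ k : ℤ, (1 + |(k : ℝ)| ^ 2) ^ t * ‖fourierCoeff w k‖ ^ 2 ≤
      4 * ((1 + |(k : ℝ)| ^ 2) ^ (1 / 2 : ℝ) * ‖fourierCoeff w k‖ ^ 2 +
        (1 + |(k : ℝ)| ^ 2) ^ s * ‖fourierCoeff w k‖ ^ 2 / R ^ 2) := by
    intro k
    have h1 := rpow_interpolate_le (s := s) (hl0 k) hR hθ0.le hθ1
    have h2 : (1 + |(k : ℝ)| ^ 2) ^ t ≤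
        4 * ((1 + |(k : ℝ)| ^ 2) ^ (1 / 2 : ℝ) + (1 + |(k : ℝ)| ^ 2) ^ s / R ^ 2) :=
      h1.trans (mul_le_mul_of_nonneg_right hRθ (by positivity))
    refine (mul_le_mul_of_nonneg_right h2 (sq_nonneg ‖fourierCoeff w k‖)).trans_eq ?_
    ring
  have hmaj := (hhalf.add (hsum.div_const (R ^ 2))).mul_left 4
  have hf := Summable.of_nonneg_of_le (fun _ => by positivity) hterm hmaj
  have hM : ∑' k : ℤ, (1 + |(k : ℝ)| ^ 2) ^ t * ‖fourierCoeff w k‖ ^ 2 ≤ 8 * A ^ 2 := by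
    refine (hf.tsum_le_tsum hterm hmaj).trans_eq ?_
    rw [tsum_mul_left, hhalf.tsum_add (hsum.div_const _), tsum_div_const, ← hA2, ← hB2, hRdef]
    have : B ≠ 0 := (hA.trans_le hAB).ne'
    field_simp
    ring
  obtain ⟨hg, hK⟩ := summable_and_tsum_japanese_le ht1
  have hinv : ∀ k : ℤ, (1 + |(k : ℝ)| ^ 2) ^ (-t) = ((1 + |(k : ℝ)| ^ 2) ^ t)⁻¹ := fun k =>
    Real.rpow_neg (hl0 k).le t
  simp only [hinv] at hg hK
  have hK' : 2 * 2 ^ t * (1 + 1 / (2 * t - 1)) ≤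
      2 * 2 ^ s * ((1 + 1 / (2 * s - 1)) / Real.log 2) * L := by
    have h1 : (2 : ℝ) ^ t ≤ 2 ^ s := Real.rpow_le_rpow_of_exponent_le (by norm_num) hts
    have h2 : 1 + 1 / (2 * t - 1) ≤ (1 + 1 / (2 * s - 1)) / Real.log 2 * L := by
      have h3 : 1 / (2 * t - 1) = 1 / (2 * s - 1) / Real.log 2 * L := by
        have : 2 * t - 1 = (2 * s - 1) * (Real.log 2 / L) := by rw [ht, hθ]; ring
        rw [this]
        field_simp
      have h4 : 1 ≤ 1 / Real.log 2 * L := by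
        rw [one_div_mul_eq_div]
        exact (one_le_div hlog2).2 hL2
      rw [h3, add_div, add_mul]
      linarith
    have h5 : 0 ≤ 1 + 1 / (2 * t - 1) := by
      have : 0 < 2 * t - 1 := by linarith
      positivity
    calc 2 * 2 ^ t * (1 + 1 / (2 * t - 1))
        ≤ 2 * 2 ^ s * ((1 + 1 / (2 * s - 1)) / Real.log 2 * L) :=
          mul_le_mul (by linarith) h2 h5 (by positivity)
      _ = _ := by ring
  obtain ⟨hsumm, hfin⟩ := summable_and_sq_tsum_le (fun k => norm_nonneg (fourierCoeff w k))
    (fun k => Real.rpow_pos_of_pos (hl0 k) t) hf hM hg (hK.trans hK')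
  refine (norm_le_tsum_norm_fourierCoeff hw hsumm x).trans (hfin.trans_eq ?_)
  have : 8 * A ^ 2 * (2 * 2 ^ s * ((1 + 1 / (2 * s - 1)) / Real.log 2) * L) = D * A ^ 2 * L := by
    rw [hD]; ring
  rw [this, Real.sqrt_mul (by positivity), Real.sqrt_mul hDpos.le, Real.sqrt_sq hA.le]

end
end

section
/- (Strichartz estimate for the fractional half-wave propagator.) Let $\frac{2}{3} < \alpha < 1$ and $\gamma > \frac{1}{2} - \frac{\alpha}{4}$. There exists $C_{\alpha,\gamma} > 0$ such that for every $u \in H^\gamma(\mathbb{T})$, $\|e^{-it|D|^\alpha} u\|_{L^4((0,1)_t, L^\infty(\mathbb{T}))} \leq C_{\alpha,\gamma} \|u\|_{H^\gamma}$. -/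
open Real Complex MeasureTheory ENNReal

/-- The reciprocal of `e^{id} - 1`, in terms of the half-angle cotangent. -/
lemma inv_cexp_sub_one_mul (d : ℝ) (hs : Real.sin (d / 2) ≠ 0) :
    (-1 / 2 - Complex.I / 2 * ((Real.cos (d / 2) / Real.sin (d / 2) : ℝ) : ℂ)) *
      (Complex.exp (Complex.I * d) - 1) = 1 := by
  have h1 : Complex.exp (Complex.I * d) =
      (Complex.cos (d / 2 : ℝ) + Complex.sin (d / 2 : ℝ) * Complex.I) ^ 2 := by
    rw [← Complex.exp_mul_I, ← Complex.exp_nat_mul]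
    congr 1
    push_cast
    ring
  have hs' : Complex.sin (d / 2 : ℝ) ≠ 0 := by
    rw [← Complex.ofReal_sin]
    exact_mod_cast hs
  have h2 := Complex.sin_sq_add_cos_sq (d / 2 : ℝ)
  rw [h1]
  push_cast at *
  set a := Complex.cos (d / 2)
  set b := Complex.sin (d / 2)
  have hI : Complex.I ^ 2 = -1 := Complex.I_sq
  field_simp
  have hI3 : Complex.I ^ 3 = -Complex.I := by rw [pow_succ, hI]; ring
  ring_nf
  rw [hI3, hI]
  linear_combination (b - a * I) * h2

/-- The Kusmin–Landau inequality: an exponential sum whose phase increments are monotone and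
stay away from `2πℤ` is bounded. -/
lemma norm_sum_cexp_le_of_monotone_increments (φ : ℕ → ℝ) (n : ℕ) (θ : ℝ) (hθ : 0 < θ)
    (hmono : ∀ k, k + 1 < n → φ (k + 1) - φ k ≤ φ (k + 2) - φ (k + 1))
    (hlow : ∀ k < n, θ ≤ φ (k + 1) - φ k)
    (hupp : ∀ k < n, φ (k + 1) - φ k ≤ 2 * π - θ) :
    ‖∑ k ∈ Finset.range n, Complex.exp (Complex.I * φ k)‖ ≤ 2 * π / θ := by
  have hpi := Real.pi_pos
  rcases n with _ | n
  · simp; positivity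
  set c : ℕ → ℝ := fun k => Real.cos ((φ (k + 1) - φ k) / 2) / Real.sin ((φ (k + 1) - φ k) / 2)
    with hc
  set b : ℕ → ℂ := fun k => -1 / 2 - Complex.I / 2 * ((c k : ℝ) : ℂ) with hb
  set e : ℕ → ℂ := fun k => Complex.exp (Complex.I * φ k) with he
  have henorm : ∀ k, ‖e k‖ = 1 := fun k => by
    simp only [he]
    rw [mul_comm]
    exact Complex.norm_exp_ofReal_mul_I _
  have hs : ∀ k < n + 1, θ / π ≤ Real.sin ((φ (k + 1) - φ k) / 2) := by
    intro k hk
    have h1 := hlow k hk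
    have h2 := hupp k hk
    rcases le_total ((φ (k + 1) - φ k) / 2) (π / 2) with h | h
    · have := Real.mul_le_sin (x := (φ (k + 1) - φ k) / 2) (by linarith) h
      refine le_trans ?_ this
      rw [div_mul_div_comm, div_le_div_iff₀ hpi (by positivity)]
      nlinarith
    · have := Real.mul_le_sin (x := π - (φ (k + 1) - φ k) / 2) (by linarith) (by linarith)
      rw [Real.sin_pi_sub] at this
      refine le_trans ?_ this
      rw [div_mul_eq_mul_div, div_le_div_iff_of_pos_right hpi]
      linarith
  have hspos : ∀ k < n + 1, 0 < Real.sin ((φ (k + 1) - φ k) / 2) := fun k hk =>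
    lt_of_lt_of_le (by positivity) (hs k hk)
  have hstep : ∀ k < n + 1, b k * (e (k + 1) - e k) = e k := by
    intro k hk
    have h := inv_cexp_sub_one_mul (φ (k + 1) - φ k) (hspos k hk).ne'
    have h' : e (k + 1) = e k * Complex.exp (Complex.I * ((φ (k + 1) - φ k : ℝ) : ℂ)) := by
      simp only [he]
      rw [← Complex.exp_add]
      congr 1
      push_cast
      ring
    rw [h']
    calc _ = e k * (b k * (Complex.exp (Complex.I * ((φ (k + 1) - φ k : ℝ) : ℂ)) - 1)) := by ring
      _ = e k := by rw [h, mul_one]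
  have hanti : ∀ k, k + 1 < n + 1 → c (k + 1) ≤ c k := by
    intro k hk
    have h1 := hspos k (by omega)
    have h2 := hspos (k + 1) hk
    simp only [hc]
    rw [div_le_div_iff₀ h2 h1]
    have h3 : 0 ≤ Real.sin ((φ (k + 1 + 1) - φ (k + 1)) / 2 - (φ (k + 1) - φ k) / 2) := by
      apply Real.sin_nonneg_of_nonneg_of_le_pi
      · have := hmono k hk
        show 0 ≤ (φ (k + 2) - φ (k + 1)) / 2 - _
        linarith
      · have := hupp (k + 1) hk
        have := hlow k (by omega)
        linarith
    rw [Real.sin_sub] at h3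
    linarith
  have key : ∀ m < n + 1, ‖∑ k ∈ Finset.range (m + 1), e k - b m * e (m + 1) + b 0 * e 0‖
      ≤ (c 0 - c m) / 2 := by
    intro m
    induction m with
    | zero =>
      intro h0
      have := hstep 0 h0
      have h : ∑ k ∈ Finset.range (0 + 1), e k - b 0 * e (0 + 1) + b 0 * e 0 = 0 := by
        rw [Finset.sum_range_one]
        linear_combination -this
      rw [h]
      simp
    | succ m ih =>
      intro hm
      have h1 := ih (by omega)
      have h2 := hstep (m + 1) hm
      have h : ∑ k ∈ Finset.range (m + 1 + 1), e k - b (m + 1) * e (m + 1 + 1) + b 0 * e 0 =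
          (∑ k ∈ Finset.range (m + 1), e k - b m * e (m + 1) + b 0 * e 0) +
          (b m - b (m + 1)) * e (m + 1) := by
        rw [Finset.sum_range_succ]
        linear_combination -h2
      rw [h]
      refine (norm_add_le _ _).trans ?_
      have h3 : ‖(b m - b (m + 1)) * e (m + 1)‖ = (c m - c (m + 1)) / 2 := by
        rw [norm_mul, henorm, mul_one]
        have : b m - b (m + 1) = ((-(c m - c (m + 1)) / 2 : ℝ) : ℂ) * Complex.I := by
          simp only [hb]
          push_cast
          ring
        rw [this, norm_mul, Complex.norm_I, mul_one, Complex.norm_real, Real.norm_eq_abs,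
          neg_div, abs_neg, abs_of_nonneg]
        have := hanti m hm
        linarith
      linarith
  have hcb : ∀ k < n + 1, |c k| ≤ π / θ := by
    intro k hk
    have h1 := hs k hk
    have h2 := hspos k hk
    simp only [hc]
    rw [abs_div, abs_of_pos h2]
    calc _ ≤ 1 / Real.sin ((φ (k + 1) - φ k) / 2) := by
          gcongr
          exact Real.abs_cos_le_one _
      _ ≤ 1 / (θ / π) := by gcongr
      _ = π / θ := by rw [one_div_div]
  have hbb : ∀ k < n + 1, ‖b k‖ ≤ π / θ / 2 := by
    intro k hk
    have h2 := hspos k hk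
    have h3 : ‖b k‖ * ‖e (k + 1) - e k‖ = 1 := by
      rw [← norm_mul, hstep k hk, henorm]
    have h4 : ‖e (k + 1) - e k‖ = 2 * Real.sin ((φ (k + 1) - φ k) / 2) := by
      have h' : e (k + 1) - e k =
          e k * (Complex.exp (Complex.I * ((φ (k + 1) - φ k : ℝ) : ℂ)) - 1) := by
        simp only [he]
        rw [mul_sub, ← Complex.exp_add, mul_one]
        congr 2
        push_cast
        ring
      rw [h', norm_mul, henorm, one_mul, Complex.norm_exp_I_mul_ofReal_sub_one, norm_mul,
        Real.norm_of_nonneg h2.le, Real.norm_of_nonneg zero_le_two]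
    rw [h4] at h3
    have h5 := hs k hk
    have h6 : ‖b k‖ = 1 / (2 * Real.sin ((φ (k + 1) - φ k) / 2)) := by
      field_simp
      linarith
    rw [h6]
    calc _ ≤ 1 / (2 * (θ / π)) := by gcongr
      _ = π / θ / 2 := by field_simp
  have h1 := key n (by omega)
  have h2 := abs_le.1 (hcb 0 (by omega))
  have h3 := abs_le.1 (hcb n (by omega))
  have h4 := hbb 0 (by omega)
  have h5 := hbb n (by omega)
  have h6 : ∑ k ∈ Finset.range (n + 1), e k =
      (∑ k ∈ Finset.range (n + 1), e k - b n * e (n + 1) + b 0 * e 0) + b n * e (n + 1)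
        - b 0 * e 0 := by ring
  rw [h6]
  refine (norm_sub_le _ _).trans ?_
  refine (add_le_add_left (norm_add_le _ _) _).trans ?_
  rw [norm_mul, norm_mul, henorm, henorm]
  have : 2 * π / θ = 2 * (π / θ) := by ring
  rw [this]
  linarith

lemma exists_threshold_of_monotone (d : ℕ → ℝ) (τ : ℝ) (n : ℕ)
    (hd : ∀ k, k + 1 < n → d k ≤ d (k + 1)) :
    ∃ p ≤ n, (∀ k < p, d k < τ) ∧ ∀ k, p ≤ k → k < n → τ ≤ d k := by
  classical
  by_cases h : ∃ k, n ≤ k ∨ τ ≤ d k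
  · refine ⟨Nat.find h, Nat.find_min' h (Or.inl le_rfl), fun k hk => ?_, fun k hk => ?_⟩
    · have := Nat.find_min h hk
      push Not at this
      exact this.2
    · induction k, hk using Nat.le_induction with
      | base =>
        intro hn
        exact (Nat.find_spec h).resolve_left (by omega)
      | succ k hk ih =>
        intro hn
        exact (ih (by omega)).trans (hd k hn)
  · exact absurd ⟨n, Or.inl le_rfl⟩ h

/-- Second-derivative test for exponential sums whose phase increments range over an interval of
length one. -/
lemma norm_sum_cexp_le_of_convex (φ : ℕ → ℝ) (n : ℕ) (lam D : ℝ) (hl : 0 < lam) (hl1 : lam ≤ 1)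
    (hconv : ∀ k, k + 1 < n → φ (k + 1) - φ k + lam ≤ φ (k + 2) - φ (k + 1))
    (hlow : ∀ k < n, D ≤ φ (k + 1) - φ k)
    (hupp : ∀ k < n, φ (k + 1) - φ k ≤ D + 1) :
    ‖∑ k ∈ Finset.range n, Complex.exp (Complex.I * φ k)‖ ≤ 16 / √lam := by
  wlog hD : -π ≤ D ∧ D < π generalizing φ D with H
  · have hpi := Real.pi_pos
    set z : ℤ := ⌊(D + π) / (2 * π)⌋ with hz
    have h1 : (z : ℝ) ≤ (D + π) / (2 * π) := Int.floor_le _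
    have h2 : (D + π) / (2 * π) < z + 1 := Int.lt_floor_add_one _
    rw [le_div_iff₀ (by positivity)] at h1
    rw [div_lt_iff₀ (by positivity)] at h2
    have := H (fun k => φ k - k * (z * (2 * π))) (D - z * (2 * π))
      (fun k hk => by have := hconv k hk; push_cast; linarith)
      (fun k hk => by have := hlow k hk; push_cast; linarith)
      (fun k hk => by have := hupp k hk; push_cast; linarith)
      ⟨by linarith, by linarith⟩
    refine le_of_eq_of_le ?_ this
    congr 1
    refine Finset.sum_congr rfl fun k _ => ?_
    rw [Complex.exp_eq_exp_iff_exists_int]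
    refine ⟨k * z, ?_⟩
    push_cast
    ring
  obtain ⟨hD1, hD2⟩ := hD
  have hpi3 := Real.pi_gt_three
  have hpi4 := Real.pi_lt_d2
  set θ := √lam with hθdef
  have hθ : 0 < θ := Real.sqrt_pos.2 hl
  have hθ1 : θ ≤ 1 := by rw [hθdef]; exact Real.sqrt_le_one.2 hl1
  have hθ2 : θ * θ = lam := Real.mul_self_sqrt hl.le
  have hmono : ∀ k, k + 1 < n → φ (k + 1) - φ k ≤ φ (k + 1 + 1) - φ (k + 1) := fun k hk => by
    have := hconv k hk
    show _ ≤ φ (k + 2) - _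
    linarith
  obtain ⟨p, hpn, hp1, hp2⟩ := exists_threshold_of_monotone (fun k => φ (k + 1) - φ k) (-θ) n hmono
  obtain ⟨q, hqn, hq1, hq2⟩ := exists_threshold_of_monotone (fun k => φ (k + 1) - φ k) θ n hmono
  have hpq : p ≤ q := by
    by_contra! h
    have h1 := hp1 q h
    have h2 := hq2 q le_rfl (by omega)
    linarith
  have hsplit : ∑ k ∈ Finset.range n, Complex.exp (Complex.I * φ k) =
      ∑ k ∈ Finset.range p, Complex.exp (Complex.I * φ k) +
      ∑ k ∈ Finset.Ico p q, Complex.exp (Complex.I * φ k) +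
      ∑ k ∈ Finset.range (n - q), Complex.exp (Complex.I * φ (q + k)) := by
    rw [Finset.sum_range_add_sum_Ico _ hpq,
      ← Finset.sum_Ico_eq_sum_range (fun k => Complex.exp (Complex.I * φ k)) q n,
      Finset.sum_range_add_sum_Ico _ hqn]
  have b1 : ‖∑ k ∈ Finset.range p, Complex.exp (Complex.I * φ k)‖ ≤ 2 * π / θ := by
    have := norm_sum_cexp_le_of_monotone_increments (fun k => φ k + k * (2 * π)) p θ hθ
      (fun k hk => by have := hconv k (by omega); push_cast; linarith)
      (fun k hk => by have := hlow k (by omega); push_cast; linarith)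
      (fun k hk => by have := hp1 k hk; push_cast; linarith)
    refine le_of_eq_of_le ?_ this
    congr 1
    refine Finset.sum_congr rfl fun k _ => ?_
    rw [Complex.exp_eq_exp_iff_exists_int]
    refine ⟨-k, ?_⟩
    push_cast
    ring
  have b3 : ‖∑ k ∈ Finset.range (n - q), Complex.exp (Complex.I * φ (q + k))‖ ≤ 2 * π / θ :=
    norm_sum_cexp_le_of_monotone_increments (fun k => φ (q + k)) (n - q) θ hθ
      (fun k hk => hmono (q + k) (by omega))
      (fun k hk => hq2 (q + k) (by omega) (by omega))
      (fun k hk => by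
        have := hupp (q + k) (by omega)
        show φ (q + k + 1) - _ ≤ _
        linarith)
  have b2 : ‖∑ k ∈ Finset.Ico p q, Complex.exp (Complex.I * φ k)‖ ≤ 3 / θ := by
    have hc : ‖∑ k ∈ Finset.Ico p q, Complex.exp (Complex.I * φ k)‖ ≤ ((q - p : ℕ) : ℝ) := by
      refine (norm_sum_le _ _).trans (le_of_eq ?_)
      rw [← Nat.card_Ico, Finset.card_eq_sum_ones, Nat.cast_sum]
      refine Finset.sum_congr rfl fun k _ => ?_
      rw [mul_comm, Complex.norm_exp_ofReal_mul_I, Nat.cast_one]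
    refine hc.trans ?_
    rcases hpq.eq_or_lt with h | h
    · rw [h, Nat.sub_self, Nat.cast_zero]
      positivity
    have hind : ∀ k, p + k < n → φ (p + 1) - φ p + k * lam ≤ φ (p + k + 1) - φ (p + k) := by
      intro k
      induction k with
      | zero => intro _; simp
      | succ k ih =>
        intro hk
        have h1 := ih (by omega)
        have h2 := hconv (p + k) hk
        show _ ≤ φ (p + k + 2) - φ (p + k + 1)
        push_cast
        linarith
    have h1 := hind (q - p - 1) (by omega)
    have h2 := hp2 p le_rfl (by omega)
    have h3 := hq1 (q - 1) (by omega)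
    have e1 : p + (q - p - 1) = q - 1 := by omega
    rw [e1] at h1
    have e2 : ((q - p - 1 : ℕ) : ℝ) = ((q - p : ℕ) : ℝ) - 1 := by
      rw [Nat.cast_sub (by omega), Nat.cast_one]
    rw [e2] at h1
    rw [le_div_iff₀ hθ]
    have h4 : ((q - p : ℕ) : ℝ) * lam ≤ 3 * θ := by nlinarith
    rw [← hθ2, ← mul_assoc] at h4
    exact le_of_mul_le_mul_right h4 hθ
  rw [hsplit]
  refine (norm_add₃_le).trans ?_
  calc _ ≤ 2 * π / θ + 3 / θ + 2 * π / θ := by gcongr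
    _ = (2 * π + 3 + 2 * π) / θ := by ring
    _ ≤ 16 / θ := by gcongr; linarith

/-- The `TT*` argument from `ℓ²` to `ℓ⁴`: if the Gram kernel of `E` has rows bounded in `ℓ²`,
then `E` is bounded from `ℓ²` to `ℓ⁴`. -/
lemma sum_norm_pow_four_le_of_gram {κ ι : Type*} (s : Finset κ) (J : Finset ι)
    (E : κ → ι → ℂ) (c : κ → ℂ) (A : ℝ) (hA0 : 0 ≤ A)
    (hA : ∀ j ∈ J, ∑ l ∈ J, ‖∑ k ∈ s, E k j * (starRingEnd ℂ) (E k l)‖ ^ 2 ≤ A) :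
    ∑ j ∈ J, ‖∑ k ∈ s, c k * E k j‖ ^ 4 ≤ A * (∑ k ∈ s, ‖c k‖ ^ 2) ^ 2 := by
  set z : ι → ℂ := fun j => ∑ k ∈ s, c k * E k j with hz
  set g : ι → ℝ := fun j => ‖z j‖ with hg
  set a : ι → ι → ℝ := fun j l => ‖∑ k ∈ s, E k j * (starRingEnd ℂ) (E k l)‖ with ha
  set w : ι → ℂ := fun j => (g j : ℂ) ^ 2 * (starRingEnd ℂ) (z j) with hw
  set S : ℝ := ∑ j ∈ J, g j ^ 4 with hS
  set B : ℝ := ∑ k ∈ s, ‖c k‖ ^ 2 with hB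
  set Q : ℝ := ∑ k ∈ s, ‖∑ j ∈ J, w j * E k j‖ ^ 2 with hQ
  have hg0 : ∀ j, 0 ≤ g j := fun j => norm_nonneg _
  have hS0 : 0 ≤ S := Finset.sum_nonneg fun j _ => by positivity
  have hwn : ∀ j, ‖w j‖ = g j ^ 3 := fun j => by
    simp only [hw, norm_mul, norm_pow, Complex.norm_real, RCLike.norm_conj, hg, norm_norm]
    ring
  have hsymm : ∀ j l, a j l = a l j := fun j l => by
    simp only [ha]
    rw [← RCLike.norm_conj, map_sum]
    congr 1
    refine Finset.sum_congr rfl fun k _ => ?_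
    rw [map_mul, Complex.conj_conj, mul_comm]
  have h1 : S ^ 2 ≤ B * Q := by
    have e1 : (S : ℂ) = ∑ k ∈ s, c k * ∑ j ∈ J, w j * E k j := by
      simp only [Finset.mul_sum]
      rw [Finset.sum_comm, hS, Complex.ofReal_sum]
      refine Finset.sum_congr rfl fun j _ => ?_
      have : ∑ k ∈ s, c k * (w j * E k j) = w j * z j := by
        simp only [hz, Finset.mul_sum]
        exact Finset.sum_congr rfl fun k _ => by ring
      rw [this]
      simp only [hw]
      rw [mul_assoc, Complex.conj_mul']
      simp only [hg]
      push_cast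
      ring
    have e2 : S ≤ ∑ k ∈ s, ‖c k‖ * ‖∑ j ∈ J, w j * E k j‖ := by
      calc S = ‖(S : ℂ)‖ := by rw [Complex.norm_real, Real.norm_of_nonneg hS0]
        _ ≤ _ := by
          rw [e1]
          refine (norm_sum_le _ _).trans (le_of_eq ?_)
          simp only [norm_mul]
    calc S ^ 2 ≤ (∑ k ∈ s, ‖c k‖ * ‖∑ j ∈ J, w j * E k j‖) ^ 2 := by gcongr
      _ ≤ B * Q := Finset.sum_mul_sq_le_sq_mul_sq _ _ _
  have h2 : Q ≤ ∑ p ∈ J ×ˢ J, (g p.1 ^ 2 * g p.2 ^ 2) * (g p.1 * g p.2 * a p.1 p.2) := by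
    have e1 : (Q : ℂ) = ∑ p ∈ J ×ˢ J, w p.1 * (starRingEnd ℂ) (w p.2) *
        ∑ k ∈ s, E k p.1 * (starRingEnd ℂ) (E k p.2) := by
      simp only [Finset.mul_sum]
      rw [Finset.sum_comm, hQ, Complex.ofReal_sum]
      refine Finset.sum_congr rfl fun k _ => ?_
      rw [Complex.ofReal_pow, ← Complex.mul_conj', map_sum, Finset.sum_mul_sum,
        Finset.sum_product]
      refine Finset.sum_congr rfl fun j _ => Finset.sum_congr rfl fun l _ => ?_
      rw [map_mul]
      ring
    have hQ0 : 0 ≤ Q := Finset.sum_nonneg fun k _ => by positivity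
    calc Q = ‖(Q : ℂ)‖ := by rw [Complex.norm_real, Real.norm_of_nonneg hQ0]
      _ ≤ _ := by
        rw [e1]
        refine (norm_sum_le _ _).trans (le_of_eq ?_)
        refine Finset.sum_congr rfl fun p _ => ?_
        rw [norm_mul, norm_mul, RCLike.norm_conj, hwn, hwn]
        simp only [ha]
        ring
  have h3 : (∑ p ∈ J ×ˢ J, (g p.1 ^ 2 * g p.2 ^ 2) * (g p.1 * g p.2 * a p.1 p.2)) ^ 2 ≤
      S ^ 2 * (A * S) := by
    refine (Finset.sum_mul_sq_le_sq_mul_sq _ _ _).trans ?_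
    have e1 : ∑ p ∈ J ×ˢ J, (g p.1 ^ 2 * g p.2 ^ 2) ^ 2 = S ^ 2 := by
      rw [pow_two S, hS, Finset.sum_mul_sum, Finset.sum_product]
      refine Finset.sum_congr rfl fun j _ => Finset.sum_congr rfl fun l _ => ?_
      ring
    have e2 : ∑ p ∈ J ×ˢ J, (g p.1 * g p.2 * a p.1 p.2) ^ 2 ≤ A * S := by
      have f1 : ∑ j ∈ J, ∑ l ∈ J, g j ^ 4 * a j l ^ 2 ≤ A * S := by
        rw [hS, Finset.mul_sum]
        refine Finset.sum_le_sum fun j hj => ?_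
        rw [← Finset.mul_sum, mul_comm]
        exact mul_le_mul_of_nonneg_right (hA j hj) (by positivity)
      have f2 : ∑ j ∈ J, ∑ l ∈ J, g l ^ 4 * a j l ^ 2 ≤ A * S := by
        rw [Finset.sum_comm]
        simpa only [hsymm] using f1
      have f3 : ∑ p ∈ J ×ˢ J, (g p.1 * g p.2 * a p.1 p.2) ^ 2 ≤
          (∑ j ∈ J, ∑ l ∈ J, g j ^ 4 * a j l ^ 2 +
            ∑ j ∈ J, ∑ l ∈ J, g l ^ 4 * a j l ^ 2) / 2 := by
        rw [← Finset.sum_add_distrib, Finset.sum_product, Finset.sum_div]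
        refine Finset.sum_le_sum fun j _ => ?_
        rw [← Finset.sum_add_distrib, Finset.sum_div]
        refine Finset.sum_le_sum fun l _ => ?_
        nlinarith [mul_nonneg (sq_nonneg (g j ^ 2 - g l ^ 2)) (sq_nonneg (a j l))]
      linarith
    rw [e1]
    gcongr
  rcases hS0.eq_or_lt with h0 | hpos
  · change S ≤ _
    rw [← h0]
    positivity
  · have hQ0 : 0 ≤ Q := Finset.sum_nonneg fun k _ => by positivity
    have h4 : Q ^ 2 ≤ S ^ 2 * (A * S) := le_trans (by gcongr) h3
    have h5 : S ^ 3 * S ≤ S ^ 3 * (A * B ^ 2) := by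
      calc S ^ 3 * S = (S ^ 2) ^ 2 := by ring
        _ ≤ (B * Q) ^ 2 := by gcongr
        _ = B ^ 2 * Q ^ 2 := by ring
        _ ≤ B ^ 2 * (S ^ 2 * (A * S)) := by gcongr
        _ = _ := by ring
    exact le_of_mul_le_mul_left h5 (by positivity)

lemma sum_inv_range_two_pow_le (m : ℕ) : ∑ i ∈ Finset.range (2 ^ m), ((i : ℝ))⁻¹ ≤ m := by
  induction m with
  | zero => simp
  | succ m ih =>
    rw [← Finset.sum_range_add_sum_Ico _ (Nat.pow_le_pow_right two_pos m.le_succ)]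
    have : ∑ i ∈ Finset.Ico (2 ^ m) (2 ^ (m + 1)), ((i : ℕ) : ℝ)⁻¹ ≤ 1 := by
      calc _ ≤ ∑ _i ∈ Finset.Ico (2 ^ m) (2 ^ (m + 1)), ((2 : ℝ) ^ m)⁻¹ := by
            refine Finset.sum_le_sum fun i hi => ?_
            have := (Finset.mem_Ico.1 hi).1
            gcongr
            exact_mod_cast this
        _ = 1 := by
          rw [Finset.sum_const, Nat.card_Ico, pow_succ, nsmul_eq_mul]
          have : 2 ^ m * 2 - 2 ^ m = 2 ^ m := by omega
          rw [this]
          push_cast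
          field_simp
    push_cast
    linarith

lemma sum_inv_abs_sub_le (j M : ℕ) (hj : j < M) :
    ∑ l ∈ Finset.range M, (|(j : ℝ) - l|)⁻¹ ≤ 2 * ∑ i ∈ Finset.range M, ((i : ℝ))⁻¹ := by
  have h1 : ∑ l ∈ Finset.range (j + 1), (|(j : ℝ) - l|)⁻¹ ≤ ∑ i ∈ Finset.range M, ((i : ℝ))⁻¹ := by
    rw [← Finset.sum_range_reflect]
    have : ∀ i ∈ Finset.range (j + 1), (|(j : ℝ) - ((j + 1 - 1 - i : ℕ) : ℝ)|)⁻¹ = (i : ℝ)⁻¹ := by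
      intro i hi
      have := Finset.mem_range.1 hi
      rw [Nat.add_sub_cancel, Nat.cast_sub (by omega), _root_.sub_sub_cancel, Nat.abs_cast]
    rw [Finset.sum_congr rfl this]
    refine Finset.sum_le_sum_of_subset_of_nonneg (Finset.range_subset_range.2 hj) fun i _ _ => ?_
    positivity
  have h2 : ∑ l ∈ Finset.Ico (j + 1) M, (|(j : ℝ) - l|)⁻¹ ≤
      ∑ i ∈ Finset.range M, ((i : ℝ))⁻¹ := by
    rw [Finset.sum_Ico_eq_sum_range]
    have : ∀ i ∈ Finset.range (M - (j + 1)),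
        (|(j : ℝ) - ((j + 1 + i : ℕ) : ℝ)|)⁻¹ = ((i + 1 : ℕ) : ℝ)⁻¹ := by
      intro i hi
      push_cast
      rw [show (j : ℝ) - (j + 1 + i) = -(i + 1) by ring, abs_neg, abs_of_nonneg (by positivity)]
    rw [Finset.sum_congr rfl this]
    calc _ ≤ ∑ i ∈ Finset.range (M - 1), ((i + 1 : ℕ) : ℝ)⁻¹ := by
          refine Finset.sum_le_sum_of_subset_of_nonneg (Finset.range_subset_range.2 (by omega))
            fun i _ _ => ?_
          positivity
      _ = _ := by
        have : M = M - 1 + 1 := by omega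
        rw [this, Finset.sum_range_succ', Nat.add_sub_cancel]
        simp
  rw [← Finset.sum_range_add_sum_Ico _ (show j + 1 ≤ M from hj)]
  linarith

/-- The second differences of `y ↦ y ^ α` are quantitatively negative. -/
lemma rpow_second_difference_lower (α : ℝ) (h0 : 0 < α) (h1 : α < 1) (y R : ℝ) (hy : 0 < y)
    (hR : y + 2 ≤ R) :
    α * (1 - α) * R ^ (α - 2) ≤ 2 * (y + 1) ^ α - y ^ α - (y + 2) ^ α := by
  obtain ⟨ξ, hξ, hξ'⟩ := exists_hasDerivAt_eq_slope (fun s : ℝ => (s + 1) ^ α - s ^ α)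
    (fun s => α * (s + 1) ^ (α - 1) - α * s ^ (α - 1)) (show y < y + 1 by linarith)
    (fun s hs => by
      have : 0 < s := hy.trans_le hs.1
      apply ContinuousAt.continuousWithinAt
      exact ((continuousAt_id.add continuousAt_const).rpow_const (Or.inl (by simp; linarith))).sub
        (continuousAt_id.rpow_const (Or.inl (by simp; linarith))))
    (fun s hs => by
      have : 0 < s := hy.trans hs.1
      have e1 := (Real.hasDerivAt_rpow_const (x := s + 1) (p := α)
        (Or.inl (by linarith))).comp_add_const s 1
      exact e1.sub (Real.hasDerivAt_rpow_const (x := s) (p := α) (Or.inl (by linarith))))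
  have hξ0 : 0 < ξ := hy.trans hξ.1
  obtain ⟨η, hη, hη'⟩ := exists_hasDerivAt_eq_slope (fun s : ℝ => s ^ (α - 1))
    (fun s => (α - 1) * s ^ (α - 1 - 1)) (show ξ < ξ + 1 by linarith)
    (fun s hs => by
      have : 0 < s := hξ0.trans_le hs.1
      apply ContinuousAt.continuousWithinAt
      exact (continuousAt_id.rpow_const (Or.inl (by simp; linarith))))
    (fun s hs => by
      have : 0 < s := hξ0.trans hs.1
      exact Real.hasDerivAt_rpow_const (x := s) (Or.inl (by linarith)))
  have hη0 : 0 < η := hξ0.trans hη.1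
  have hηR : η ≤ R := by linarith [hη.2, hξ.2]
  have hmono : R ^ (α - 2) ≤ η ^ (α - 2) :=
    Real.rpow_le_rpow_of_nonpos hη0 hηR (by linarith)
  simp only [add_sub_cancel_left, div_one] at hξ' hη'
  have e3 : α - 1 - 1 = α - 2 := by ring
  rw [e3] at hη'
  have e4 : y + 1 + 1 = y + 2 := by ring
  rw [e4] at hξ'
  have h5 : 2 * (y + 1) ^ α - y ^ α - (y + 2) ^ α = α * (1 - α) * η ^ (α - 2) := by
    linear_combination hξ' + α * hη'
  rw [h5]
  have : 0 ≤ α * (1 - α) := mul_nonneg h0.le (by linarith)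
  gcongr

/-- The character `e^{i(kx - |k|^α t)}` carried by the propagator, for nonnegative frequencies. -/
noncomputable def halfWave (α : ℝ) (k : ℕ) (x t : ℝ) : ℂ :=
  Complex.exp (Complex.I * (((k : ℝ) * x - (k : ℝ) ^ α * t : ℝ) : ℂ))

lemma halfWave_mul_conj (α : ℝ) (k : ℕ) (x t y s : ℝ) :
    halfWave α k x t * (starRingEnd ℂ) (halfWave α k y s) = halfWave α k (x - y) (t - s) := by
  simp only [halfWave]
  rw [← Complex.exp_conj, ← Complex.exp_add, map_mul, Complex.conj_I, Complex.conj_ofReal]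
  congr 1
  push_cast
  ring

lemma conj_halfWave (α : ℝ) (k : ℕ) (x t : ℝ) :
    (starRingEnd ℂ) (halfWave α k x t) = halfWave α k (-x) (-t) := by
  simp only [halfWave]
  rw [← Complex.exp_conj, map_mul, Complex.conj_I, Complex.conj_ofReal]
  congr 1
  push_cast
  ring

lemma norm_halfWave (α : ℝ) (k : ℕ) (x t : ℝ) : ‖halfWave α k x t‖ = 1 := by
  rw [halfWave, mul_comm, Complex.norm_exp_ofReal_mul_I]

lemma continuous_halfWave (α : ℝ) (k : ℕ) :
    Continuous fun p : ℝ × ℝ => halfWave α k p.1 p.2 := by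
  unfold halfWave
  fun_prop

lemma halfWave_add_two_pi (α : ℝ) (k : ℕ) (x t : ℝ) :
    halfWave α k (x + 2 * π) t = halfWave α k x t := by
  simp only [halfWave]
  rw [Complex.exp_eq_exp_iff_exists_int]
  refine ⟨k, ?_⟩
  push_cast
  ring

/-- Dispersive estimate for the frequency-localized kernel. -/
lemma norm_sq_sum_halfWave_le (α : ℝ) (h0 : 0 < α) (h1 : α < 1) (N : ℕ) (hN : 0 < N)
    (x t : ℝ) (ht0 : t ≠ 0) (ht1 : |t| ≤ 1) :
    ‖∑ k ∈ Finset.Ico N (2 * N), halfWave α k x t‖ ^ 2 ≤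
      1024 / (α * (1 - α)) * (N : ℝ) ^ (2 - α) * |t|⁻¹ := by
  wlog ht : 0 < t generalizing x t with H
  · have := H (-x) (-t) (neg_ne_zero.2 ht0) (by rwa [abs_neg])
      (by have := lt_of_le_of_ne (not_lt.1 ht) ht0; linarith)
    rw [abs_neg] at this
    refine le_of_eq_of_le ?_ this
    rw [← RCLike.norm_conj, map_sum]
    simp only [conj_halfWave]
  rw [abs_of_pos ht] at *
  have hNr : (1 : ℝ) ≤ N := by exact_mod_cast hN
  have hN0 : (0 : ℝ) < N := by linarith
  have ha : 0 < α * (1 - α) := mul_pos h0 (by linarith)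
  set lam : ℝ := t * (α * (1 - α) * (2 * N : ℝ) ^ (α - 2)) with hlam
  have hlam0 : 0 < lam := by positivity
  have hpow1 : (2 * N : ℝ) ^ (α - 2) ≤ 1 :=
    Real.rpow_le_one_of_one_le_of_nonpos (by linarith) (by linarith)
  have hlam1 : lam ≤ 1 := by
    have h2 : α * (1 - α) ≤ 1 := by nlinarith
    have h3 : α * (1 - α) * (2 * N : ℝ) ^ (α - 2) ≤ 1 := mul_le_one₀ h2 (by positivity) hpow1
    exact mul_le_one₀ ht1 (by positivity) h3
  have hincr : ∀ y : ℝ, 1 ≤ y → 0 ≤ (y + 1) ^ α - y ^ α ∧ (y + 1) ^ α - y ^ α ≤ 1 := by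
    intro y hy
    constructor
    · have : y ^ α ≤ (y + 1) ^ α := Real.rpow_le_rpow (by linarith) (by linarith) h0.le
      linarith
    · have := Real.rpow_add_le_add_rpow (p := α) (by linarith : 0 ≤ y) zero_le_one h0.le h1.le
      rw [Real.one_rpow] at this
      linarith
  have hvdc := norm_sum_cexp_le_of_convex
    (fun k => ((N + k : ℕ) : ℝ) * x - ((N + k : ℕ) : ℝ) ^ α * t) N lam (x - 1) hlam0 hlam1
    (fun k hk => by
      have hk' : (k : ℝ) + 1 ≤ N := by exact_mod_cast hk.le
      have hk'' : (k : ℝ) + 2 ≤ N := by exact_mod_cast hk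
      have := rpow_second_difference_lower α h0 h1 ((N : ℝ) + k) (2 * N) (by positivity)
        (by linarith)
      have := mul_le_mul_of_nonneg_left this ht.le
      rw [hlam]
      push_cast
      rw [← add_assoc, ← add_assoc]
      linarith)
    (fun k hk => by
      have := hincr ((N : ℝ) + k) (by have : (0 : ℝ) ≤ k := k.cast_nonneg; linarith)
      push_cast
      rw [← add_assoc]
      nlinarith)
    (fun k hk => by
      have := hincr ((N : ℝ) + k) (by have : (0 : ℝ) ≤ k := k.cast_nonneg; linarith)
      push_cast
      rw [← add_assoc]
      nlinarith)
  have hsum : ∑ k ∈ Finset.Ico N (2 * N), halfWave α k x t = ∑ k ∈ Finset.range N,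
      Complex.exp (Complex.I * ((((N + k : ℕ) : ℝ) * x - ((N + k : ℕ) : ℝ) ^ α * t : ℝ) : ℂ)) := by
    rw [Finset.sum_Ico_eq_sum_range, show 2 * N - N = N by omega]
    rfl
  rw [hsum]
  calc _ ≤ (16 / √lam) ^ 2 := by gcongr
    _ = 256 / lam := by rw [div_pow, Real.sq_sqrt hlam0.le]; norm_num
    _ = 256 / (α * (1 - α)) * (2 * N : ℝ) ^ (2 - α) * t⁻¹ := by
      rw [hlam, show (2 - α) = -(α - 2) by ring, Real.rpow_neg (by positivity)]
      field_simp
    _ ≤ 256 / (α * (1 - α)) * (4 * (N : ℝ) ^ (2 - α)) * t⁻¹ := by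
      gcongr
      rw [Real.mul_rpow (by norm_num) hN0.le]
      gcongr
      calc (2 : ℝ) ^ (2 - α) ≤ 2 ^ (2 : ℝ) :=
            Real.rpow_le_rpow_of_exponent_le (by norm_num) (by linarith)
        _ = 4 := by norm_num
    _ = _ := by ring

/-- Frequency-localized Strichartz estimate, discretized in time. -/
lemma sum_norm_halfWave_pow_four_le (α : ℝ) (h0 : 0 < α) (h1 : α < 1) (m : ℕ) (c : ℕ → ℂ)
    (x : ℕ → ℝ) (s : ℝ) :
    ∑ j ∈ Finset.range (2 ^ m), ‖∑ k ∈ Finset.Ico (2 ^ m) (2 ^ (m + 1)),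
        c k * halfWave α k (x j) (s + j / 2 ^ m)‖ ^ 4 ≤
      (1 + 2048 / (α * (1 - α))) * (m + 1) * 2 ^ m * ((2 : ℝ) ^ m) ^ (2 - α) *
        (∑ k ∈ Finset.Ico (2 ^ m) (2 ^ (m + 1)), ‖c k‖ ^ 2) ^ 2 := by
  have ha : 0 < α * (1 - α) := mul_pos h0 (by linarith)
  refine sum_norm_pow_four_le_of_gram _ _ (fun k j => halfWave α k (x j) (s + j / 2 ^ m)) c _
    (by positivity) fun j hj => ?_
  have hj' := Finset.mem_range.1 hj
  simp only [halfWave_mul_conj]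
  set D : ℝ := 1024 / (α * (1 - α)) * ((2 : ℝ) ^ m) ^ (2 - α) * 2 ^ m with hD
  have hD0 : 0 ≤ D := by positivity
  have hrow : ∀ l ∈ Finset.range (2 ^ m), ‖∑ k ∈ Finset.Ico (2 ^ m) (2 ^ (m + 1)),
      halfWave α k (x j - x l) (s + j / 2 ^ m - (s + l / 2 ^ m))‖ ^ 2 ≤
      (if j = l then ((2 : ℝ) ^ m) ^ 2 else 0) + D * (|(j : ℝ) - l|)⁻¹ := by
    intro l hl
    have hl' := Finset.mem_range.1 hl
    split_ifs with h
    · have : ‖∑ k ∈ Finset.Ico (2 ^ m) (2 ^ (m + 1)),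
          halfWave α k (x j - x l) (s + j / 2 ^ m - (s + l / 2 ^ m))‖ ≤ 2 ^ m := by
        refine (norm_sum_le _ _).trans (le_of_eq ?_)
        simp only [norm_halfWave]
        rw [Finset.sum_const, Nat.card_Ico, pow_succ, show 2 ^ m * 2 - 2 ^ m = 2 ^ m by omega]
        simp
      calc _ ≤ ((2 : ℝ) ^ m) ^ 2 := by gcongr
        _ ≤ _ := by
          have : 0 ≤ D * (|(j : ℝ) - l|)⁻¹ := by positivity
          linarith
    · have hne : (j : ℝ) - l ≠ 0 := by
        rw [sub_ne_zero]
        exact_mod_cast h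
      have ht : s + j / 2 ^ m - (s + l / 2 ^ m) = ((j : ℝ) - l) / 2 ^ m := by ring
      have := norm_sq_sum_halfWave_le α h0 h1 (2 ^ m) (by positivity) (x j - x l)
        (((j : ℝ) - l) / 2 ^ m) (by positivity) (by
          rw [abs_div, abs_of_pos (by positivity : (0 : ℝ) < 2 ^ m), div_le_one (by positivity),
            abs_le]
          have e1 : (j : ℝ) ≤ 2 ^ m := by exact_mod_cast hj'.le
          have e2 : (l : ℝ) ≤ 2 ^ m := by exact_mod_cast hl'.le
          have e3 : (0 : ℝ) ≤ j := j.cast_nonneg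
          have e4 : (0 : ℝ) ≤ l := l.cast_nonneg
          constructor <;> linarith)
      rw [ht, zero_add, show 2 ^ (m + 1) = 2 * 2 ^ m by ring]
      refine this.trans (le_of_eq ?_)
      rw [abs_div, abs_of_pos (by positivity : (0 : ℝ) < 2 ^ m), hD]
      push_cast
      rw [inv_div]
      ring
  refine (Finset.sum_le_sum hrow).trans ?_
  rw [Finset.sum_add_distrib, Finset.sum_ite_eq, if_pos hj, ← Finset.mul_sum]
  have h2 := sum_inv_abs_sub_le j (2 ^ m) hj'
  have h3 := sum_inv_range_two_pow_le m
  have h4 : (2 : ℝ) ^ m ≤ ((2 : ℝ) ^ m) ^ (2 - α) := by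
    calc (2 : ℝ) ^ m = ((2 : ℝ) ^ m) ^ (1 : ℝ) := (Real.rpow_one _).symm
      _ ≤ _ := Real.rpow_le_rpow_of_exponent_le (one_le_pow₀ (by norm_num)) (by linarith)
  have h5 : ((2 : ℝ) ^ m) ^ 2 ≤ 1 * (m + 1) * 2 ^ m * ((2 : ℝ) ^ m) ^ (2 - α) := by
    have h6 : (1 : ℝ) ≤ m + 1 := by
      have : (0 : ℝ) ≤ m := m.cast_nonneg
      linarith
    calc ((2 : ℝ) ^ m) ^ 2 = 1 * 1 * 2 ^ m * 2 ^ m := by ring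
      _ ≤ _ := by gcongr
  calc _ ≤ 1 * (m + 1) * 2 ^ m * ((2 : ℝ) ^ m) ^ (2 - α) + D * (2 * (m + 1)) := by
        gcongr
        linarith
    _ = _ := by
      rw [hD]
      ring

/-- `sup_x` of a frequency-localized free wave at time `t`. -/
noncomputable def blockSup (α : ℝ) (c : ℕ → ℂ) (m : ℕ) (t : ℝ) : ℝ≥0∞ :=
  ⨆ x : ℝ, (‖∑ k ∈ Finset.Ico (2 ^ m) (2 ^ (m + 1)), c k * halfWave α k x t‖₊ : ℝ≥0∞)

lemma measurable_blockSup (α : ℝ) (c : ℕ → ℂ) (m : ℕ) : Measurable (blockSup α c m) := by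
  refine LowerSemicontinuous.measurable (lowerSemicontinuous_iSup fun x => ?_)
  refine Continuous.lowerSemicontinuous ?_
  refine ENNReal.continuous_coe.comp (Continuous.nnnorm ?_)
  refine continuous_finsetSum _ fun k _ => continuous_const.mul ?_
  exact (continuous_halfWave α k).comp (by fun_prop : Continuous fun t : ℝ => (x, t))

lemma exists_blockSup_eq (α : ℝ) (c : ℕ → ℂ) (m : ℕ) (t : ℝ) :
    ∃ x : ℝ, blockSup α c m t =
      (‖∑ k ∈ Finset.Ico (2 ^ m) (2 ^ (m + 1)), c k * halfWave α k x t‖₊ : ℝ≥0∞) := by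
  set F : ℝ → ℝ := fun x => ‖∑ k ∈ Finset.Ico (2 ^ m) (2 ^ (m + 1)), c k * halfWave α k x t‖ with hF
  have hcont : Continuous F := by
    refine Continuous.norm (continuous_finsetSum _ fun k _ => continuous_const.mul ?_)
    exact (continuous_halfWave α k).comp (by fun_prop : Continuous fun x : ℝ => (x, t))
  have hper : Function.Periodic F (2 * π) := fun x => by
    simp only [hF, halfWave_add_two_pi]
  obtain ⟨_, ⟨x, rfl⟩, hx⟩ := (hper.compact_of_continuous (by positivity) hcont).exists_isGreatest
    (Set.range_nonempty F)
  refine ⟨x, le_antisymm (iSup_le fun y => ?_) (le_iSup (fun x : ℝ =>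
    (‖∑ k ∈ Finset.Ico (2 ^ m) (2 ^ (m + 1)), c k * halfWave α k x t‖₊ : ℝ≥0∞)) x)⟩
  have := hx ⟨y, rfl⟩
  exact_mod_cast this

lemma lintegral_Ioo_le_of_sum_translates_le (F : ℝ → ℝ≥0∞) (hF : Measurable F) (N : ℕ)
    (hN : 0 < N) (B : ℝ≥0∞) (hB : ∀ s : ℝ, ∑ j ∈ Finset.range N, F (s + j / N) ≤ B) :
    ∫⁻ t in Set.Ioo (0 : ℝ) 1, F t ≤ B * ENNReal.ofReal (1 / N) := by
  have hN' : (0 : ℝ) < N := by exact_mod_cast hN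
  have hcover : Set.Ioo (0 : ℝ) 1 ⊆ ⋃ j : Fin N,
      Set.Ico ((j : ℝ) / N) ((j : ℝ) / N + 1 / N) := by
    intro t ht
    rw [Set.mem_iUnion]
    have h1 := Nat.floor_le (show 0 ≤ t * N by have := ht.1; positivity)
    have h2 := Nat.lt_floor_add_one (t * N)
    have h3 : (⌊t * N⌋₊ : ℝ) < N := by nlinarith [ht.2]
    refine ⟨⟨⌊t * N⌋₊, by exact_mod_cast h3⟩, ?_, ?_⟩
    · rwa [div_le_iff₀ hN']
    · rwa [← add_div, lt_div_iff₀ hN']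
  have htrans : ∀ a : ℝ, ∫⁻ t in Set.Ico a (a + 1 / N), F t =
      ∫⁻ s in Set.Ico (0 : ℝ) (1 / N), F (s + a) := by
    intro a
    have := (measurePreserving_add_right (volume : Measure ℝ) a).setLIntegral_comp_preimage
      (s := Set.Ico a (a + 1 / N)) measurableSet_Ico hF
    rw [← this]
    congr 2
    ext s
    simp only [Set.mem_preimage, Set.mem_Ico]
    constructor <;> rintro ⟨h1, h2⟩ <;> constructor <;> linarith
  calc ∫⁻ t in Set.Ioo (0 : ℝ) 1, F t
      ≤ ∫⁻ t in ⋃ j : Fin N, Set.Ico ((j : ℝ) / N) ((j : ℝ) / N + 1 / N), F t :=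
        lintegral_mono_set hcover
    _ ≤ ∑ j ∈ Finset.range N, ∫⁻ t in Set.Ico ((j : ℝ) / N) ((j : ℝ) / N + 1 / N), F t := by
        rw [Finset.sum_range]
        exact (lintegral_iUnion_le _ _).trans_eq (tsum_fintype _)
    _ = ∫⁻ s in Set.Ico (0 : ℝ) (1 / N), ∑ j ∈ Finset.range N, F (s + j / N) := by
        rw [lintegral_finsetSum _ fun j _ => by fun_prop]
        exact Finset.sum_congr rfl fun j _ => htrans _
    _ ≤ ∫⁻ _ in Set.Ico (0 : ℝ) (1 / N), B := lintegral_mono fun s => hB s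
    _ = _ := by rw [setLIntegral_const, Real.volume_Ico, sub_zero]

/-- Frequency-localized Strichartz estimate (with a logarithmic loss). -/
lemma lintegral_blockSup_pow_four_le (α : ℝ) (h0 : 0 < α) (h1 : α < 1) (m : ℕ) (c : ℕ → ℂ) :
    ∫⁻ t in Set.Ioo (0 : ℝ) 1, blockSup α c m t ^ 4 ≤
      ENNReal.ofReal ((1 + 2048 / (α * (1 - α))) * (m + 1) * ((2 : ℝ) ^ m) ^ (2 - α) *
        (∑ k ∈ Finset.Ico (2 ^ m) (2 ^ (m + 1)), ‖c k‖ ^ 2) ^ 2) := by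
  have ha : 0 < α * (1 - α) := mul_pos h0 (by linarith)
  choose x hx using exists_blockSup_eq α c m
  refine (lintegral_Ioo_le_of_sum_translates_le _ ((measurable_blockSup α c m).pow_const 4) (2 ^ m)
    (by positivity) (ENNReal.ofReal ((1 + 2048 / (α * (1 - α))) * (m + 1) * 2 ^ m *
      ((2 : ℝ) ^ m) ^ (2 - α) * (∑ k ∈ Finset.Ico (2 ^ m) (2 ^ (m + 1)), ‖c k‖ ^ 2) ^ 2))
    fun s => ?_).trans ?_
  · refine le_trans (le_of_eq ?_) (ENNReal.ofReal_le_ofReal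
      (sum_norm_halfWave_pow_four_le α h0 h1 m c (fun j => x (s + j / 2 ^ m)) s))
    rw [ENNReal.ofReal_sum_of_nonneg fun _ _ => by positivity]
    refine Finset.sum_congr rfl fun j _ => ?_
    rw [hx, ENNReal.ofReal_pow (norm_nonneg _), ofReal_norm]
    push_cast
    rfl
  · rw [← ENNReal.ofReal_mul (by positivity)]
    refine ENNReal.ofReal_le_ofReal (le_of_eq ?_)
    push_cast
    field_simp

lemma enorm_tsum_halfWave_le (α : ℝ) (c : ℕ → ℂ) (x t : ℝ)
    (hs : Summable fun k => c k * halfWave α k x t) :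
    ‖∑' k, c k * halfWave α k x t‖ₑ ≤ ‖c 0‖ₑ + ∑' m, blockSup α c m t := by
  have hpart : ∀ n : ℕ, ‖∑ k ∈ Finset.range (2 ^ n), c k * halfWave α k x t‖ₑ ≤
      ‖c 0‖ₑ + ∑ m ∈ Finset.range n, blockSup α c m t := by
    intro n
    induction n with
    | zero =>
      simp [← ofReal_norm, norm_halfWave]
    | succ n ih =>
      rw [← Finset.sum_range_add_sum_Ico _ (Nat.pow_le_pow_right two_pos n.le_succ),
        Finset.sum_range_succ, ← add_assoc]
      refine (enorm_add_le _ _).trans (add_le_add ih ?_)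
      exact le_iSup (fun x : ℝ =>
        (‖∑ k ∈ Finset.Ico (2 ^ n) (2 ^ (n + 1)), c k * halfWave α k x t‖₊ : ℝ≥0∞)) x
  have hlim := (hs.hasSum.tendsto_sum_nat.comp
    (tendsto_pow_atTop_atTop_of_one_lt (one_lt_two : (1 : ℕ) < 2))).enorm
  refine le_of_tendsto' hlim fun n => (hpart n).trans ?_
  gcongr
  exact ENNReal.sum_le_tsum _

lemma lintegral_blockSup_pow_four_le_of_sobolev (α γ : ℝ) (h0 : 0 < α) (h1 : α < 1) (hγ : 0 < γ)
    (c : ℤ → ℂ) (hc : Summable (fun k : ℤ => (1 + |(k : ℝ)| ^ 2) ^ γ * ‖c k‖ ^ 2))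
    (σ : ℕ → ℤ) (hσ : Function.Injective σ) (hσ' : ∀ k, |(σ k : ℝ)| = k) (m : ℕ) :
    ∫⁻ t in Set.Ioo (0 : ℝ) 1, blockSup α (fun k => c (σ k)) m t ^ 4 ≤
      ENNReal.ofReal ((1 + 2048 / (α * (1 - α))) * (m + 1) *
        (((2 : ℝ) ^ (-(4 * γ - 2 + α) / 8)) ^ m) ^ 8 *
        (∑' k : ℤ, (1 + |(k : ℝ)| ^ 2) ^ γ * ‖c k‖ ^ 2) ^ 2) := by
  have ha : 0 < α * (1 - α) := mul_pos h0 (by linarith)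
  refine (lintegral_blockSup_pow_four_le α h0 h1 m _).trans (ENNReal.ofReal_le_ofReal ?_)
  set w : ℤ → ℝ := fun k => (1 + |(k : ℝ)| ^ 2) ^ γ * ‖c k‖ ^ 2 with hw
  have hw0 : ∀ k, 0 ≤ w k := fun k => by positivity
  have h2m : (0 : ℝ) < 2 ^ m := by positivity
  have hblock : ∑ k ∈ Finset.Ico (2 ^ m) (2 ^ (m + 1)), ‖c (σ k)‖ ^ 2 ≤
      ((2 : ℝ) ^ m) ^ (-(2 * γ)) * ∑' k, w k := by
    calc _ ≤ ∑ k ∈ Finset.Ico (2 ^ m) (2 ^ (m + 1)), ((2 : ℝ) ^ m) ^ (-(2 * γ)) * w (σ k) := by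
          refine Finset.sum_le_sum fun k hk => ?_
          have hk : (2 : ℝ) ^ m ≤ k := by exact_mod_cast (Finset.mem_Ico.1 hk).1
          simp only [hw]
          rw [hσ', ← mul_assoc]
          refine le_mul_of_one_le_left (by positivity) ?_
          calc (1 : ℝ) = ((2 : ℝ) ^ m) ^ (-(2 * γ)) * (((2 : ℝ) ^ m) ^ 2) ^ γ := by
                rw [← Real.rpow_natCast ((2 : ℝ) ^ m) 2, ← Real.rpow_mul h2m.le,
                  ← Real.rpow_add h2m]
                simp
            _ ≤ _ := by
                gcongr
                nlinarith
      _ = ((2 : ℝ) ^ m) ^ (-(2 * γ)) *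
          ∑ k ∈ Finset.Ico (2 ^ m) (2 ^ (m + 1)), w (σ k) := by rw [Finset.mul_sum]
      _ ≤ _ := by
          gcongr
          have := hc.sum_le_tsum ((Finset.Ico (2 ^ m) (2 ^ (m + 1))).map ⟨σ, hσ⟩)
            fun k _ => hw0 k
          rwa [Finset.sum_map] at this
  have hexp : ((2 : ℝ) ^ m) ^ (2 - α) * (((2 : ℝ) ^ m) ^ (-(2 * γ))) ^ 2 =
      (((2 : ℝ) ^ (-(4 * γ - 2 + α) / 8)) ^ m) ^ 8 := by
    rw [Real.rpow_pow_comm zero_le_two, ← Real.rpow_natCast _ 2, ← Real.rpow_natCast _ 8,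
      ← Real.rpow_mul h2m.le, ← Real.rpow_mul h2m.le, ← Real.rpow_add h2m]
    congr 1
    push_cast
    ring
  calc _ ≤ (1 + 2048 / (α * (1 - α))) * (m + 1) * ((2 : ℝ) ^ m) ^ (2 - α) *
        (((2 : ℝ) ^ m) ^ (-(2 * γ)) * ∑' k, w k) ^ 2 := by gcongr
    _ = (1 + 2048 / (α * (1 - α))) * (m + 1) *
        (((2 : ℝ) ^ m) ^ (2 - α) * (((2 : ℝ) ^ m) ^ (-(2 * γ))) ^ 2) * (∑' k, w k) ^ 2 := by ring
    _ = _ := by rw [hexp]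

/-- A weighted `ℓ⁴`–`ℓ¹` comparison: geometric decay lets a sup dominate the sum. -/
lemma tsum_add_tsum_add_pow_four_le (p : ℝ≥0∞) (a b : ℕ → ℝ≥0∞) (r : ℝ≥0∞) (hr0 : r ≠ 0)
    (hr : r ≠ ∞) :
    (3 * p + ∑' m, a m + ∑' m, b m) ^ 4 ≤ (3 + 2 * ∑' m, r ^ m) ^ 4 *
      (p ^ 4 + ∑' m, ((r ^ m)⁻¹ ^ 4 * a m ^ 4 + (r ^ m)⁻¹ ^ 4 * b m ^ 4)) := by
  set G := p ^ 4 + ∑' m, ((r ^ m)⁻¹ ^ 4 * a m ^ 4 + (r ^ m)⁻¹ ^ 4 * b m ^ 4) with hG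
  set H : ℝ≥0∞ := G ^ (1 / 4 : ℝ) with hH
  have hH4 : H ^ 4 = G := by
    rw [hH, ← ENNReal.rpow_natCast, ← ENNReal.rpow_mul]
    norm_num
  have hle : ∀ y : ℝ≥0∞, y ^ 4 ≤ G → y ≤ H := fun y hy => by
    rw [← hH4] at hy
    exact (ENNReal.pow_le_pow_left_iff four_ne_zero).1 hy
  have hterm : ∀ (m : ℕ) (y : ℝ≥0∞), (r ^ m)⁻¹ ^ 4 * y ^ 4 ≤ G → y ≤ r ^ m * H := by
    intro m y hy
    rw [← mul_pow] at hy
    have h1 : r ^ m ≠ 0 := pow_ne_zero _ hr0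
    have h2 : r ^ m ≠ ∞ := ENNReal.pow_ne_top hr
    calc y = r ^ m * ((r ^ m)⁻¹ * y) := by rw [← mul_assoc, ENNReal.mul_inv_cancel h1 h2, one_mul]
      _ ≤ r ^ m * H := by gcongr; exact hle _ hy
  have hsum : ∀ m, (r ^ m)⁻¹ ^ 4 * a m ^ 4 + (r ^ m)⁻¹ ^ 4 * b m ^ 4 ≤ G := fun m =>
    (ENNReal.le_tsum m).trans le_add_self
  have ha : ∑' m, a m ≤ (∑' m, r ^ m) * H := by
    rw [← ENNReal.tsum_mul_right]
    exact ENNReal.tsum_le_tsum fun m => hterm m _ (le_self_add.trans (hsum m))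
  have hb : ∑' m, b m ≤ (∑' m, r ^ m) * H := by
    rw [← ENNReal.tsum_mul_right]
    exact ENNReal.tsum_le_tsum fun m => hterm m _ (le_add_self.trans (hsum m))
  have hp : p ≤ H := hle _ le_self_add
  calc _ ≤ (3 * H + (∑' m, r ^ m) * H + (∑' m, r ^ m) * H) ^ 4 := by gcongr
    _ = ((3 + 2 * ∑' m, r ^ m) * H) ^ 4 := by ring
    _ = _ := by rw [mul_pow, hH4]

lemma iSup_enorm_tsum_int_le (α : ℝ) (c : ℤ → ℂ) (t : ℝ) :
    (⨆ x : ℝ, (‖∑' k : ℤ,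
      c k * Complex.exp (Complex.I * ((k : ℂ) * x - ((|(k : ℝ)| ^ α : ℝ) : ℂ) * t))‖₊ : ℝ≥0∞)) ≤
      3 * ‖c 0‖ₑ + ∑' m, blockSup α (fun k => c (k : ℤ)) m t +
        ∑' m, blockSup α (fun k => c (-(k : ℤ))) m t := by
  refine iSup_le fun x => ?_
  set f : ℤ → ℂ := fun k =>
    c k * Complex.exp (Complex.I * ((k : ℂ) * x - ((|(k : ℝ)| ^ α : ℝ) : ℂ) * t)) with hf
  change ‖∑' k, f k‖ₑ ≤ _
  by_cases hs : Summable f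
  swap
  · rw [tsum_eq_zero_of_not_summable hs]
    simp
  have hpos : (fun k : ℕ => f k) = fun k : ℕ => c (k : ℤ) * halfWave α k x t := by
    funext k
    simp only [hf, halfWave]
    push_cast
    rw [Nat.abs_cast]
  have hneg : (fun k : ℕ => f (-(k : ℤ))) = fun k : ℕ => c (-(k : ℤ)) * halfWave α k (-x) t := by
    funext k
    simp only [hf, halfWave]
    push_cast
    rw [abs_neg, Nat.abs_cast, neg_mul, mul_neg]
  have s1 : Summable fun k : ℕ => f k := hs.comp_injective Nat.cast_injective
  have s2 : Summable fun k : ℕ => f (-(k : ℤ)) :=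
    hs.comp_injective (neg_injective.comp Nat.cast_injective)
  have e0 : ‖f 0‖ₑ = ‖c 0‖ₑ := by
    have := congrFun hpos 0
    simp only [Nat.cast_zero] at this
    rw [this, enorm_mul, ← ofReal_norm (halfWave _ _ _ _), norm_halfWave, ENNReal.ofReal_one,
      mul_one]
  have hsplit : ∑' k, f k = ∑' k : ℕ, f k + ∑' k : ℕ, f (-(k : ℤ)) - f 0 :=
    (HasSum.of_nat_of_neg s1.hasSum s2.hasSum).tsum_eq
  rw [hsplit]
  refine (enorm_sub_le).trans ((add_le_add_left (enorm_add_le _ _) _).trans ?_)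
  have b1 : ‖∑' k : ℕ, f k‖ₑ ≤ ‖c 0‖ₑ + ∑' m, blockSup α (fun k => c (k : ℤ)) m t := by
    rw [hpos] at s1 ⊢
    exact enorm_tsum_halfWave_le α (fun k : ℕ => c (k : ℤ)) x t s1
  have b2 : ‖∑' k : ℕ, f (-(k : ℤ))‖ₑ ≤
      ‖c 0‖ₑ + ∑' m, blockSup α (fun k => c (-(k : ℤ))) m t := by
    rw [hneg] at s2 ⊢
    simpa using enorm_tsum_halfWave_le α (fun k : ℕ => c (-(k : ℤ))) (-x) t s2
  rw [e0]
  calc _ ≤ (‖c 0‖ₑ + ∑' m, blockSup α (fun k => c (k : ℤ)) m t) +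
        (‖c 0‖ₑ + ∑' m, blockSup α (fun k => c (-(k : ℤ))) m t) + ‖c 0‖ₑ := by gcongr
    _ = _ := by ring

/-- Strichartz estimate for the fractional propagator `e^{-it|D|^α}` on the torus:
`‖e^{-it|D|^α} u‖_{L⁴((0,1)_t, L^∞(𝕋))} ≤ C ‖u‖_{H^γ}` for `γ > 1/2 - α/4`.
Here `u` is described by its Fourier coefficients `c : ℤ → ℂ`, so that
`(e^{-it|D|^α}u)(x) = ∑_k c_k e^{i(kx - |k|^α t)}`, and the `L⁴_t L^∞_x` norm
is expressed (to the fourth power) as a Lebesgue integral in time of the fourth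
power of the sup in space. -/
theorem strichartz_fractional (α γ : ℝ) (hα : 2 / 3 < α) (hα1 : α < 1)
    (hγ : 1 / 2 - α / 4 < γ) :
    ∃ C > 0, ∀ c : ℤ → ℂ,
      Summable (fun k : ℤ => (1 + |(k : ℝ)| ^ 2) ^ γ * ‖c k‖ ^ 2) →
      (∫⁻ t in Set.Ioo (0 : ℝ) 1,
          (⨆ x : ℝ,
            (‖∑' k : ℤ,
                c k * Complex.exp (Complex.I * ((k : ℂ) * x - ((|(k : ℝ)| ^ α : ℝ) : ℂ) * t))‖₊ :
              ℝ≥0∞)) ^ 4) ≤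
        ENNReal.ofReal
          (C * Real.sqrt (∑' k : ℤ, (1 + |(k : ℝ)| ^ 2) ^ γ * ‖c k‖ ^ 2)) ^ 4 := by
  have h0 : 0 < α := by linarith
  have hγ0 : 0 < γ := by linarith
  have ha : 0 < α * (1 - α) := mul_pos h0 (by linarith)
  set q : ℝ := (2 : ℝ) ^ (-(4 * γ - 2 + α) / 8) with hq
  have hq0 : 0 < q := by positivity
  have hq1 : q < 1 := Real.rpow_lt_one_of_one_lt_of_neg one_lt_two (by linarith)
  have hq1' : 0 < 1 - q := by linarith
  set K : ℝ := 1 + 2048 / (α * (1 - α)) with hK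
  have hK0 : 0 < K := by positivity
  have hq4 : q ^ 4 < 1 := pow_lt_one₀ hq0.le hq1 four_ne_zero
  have hWs : Summable fun m : ℕ => ((m : ℝ) + 1) * (q ^ 4) ^ m := by
    have e1 := summable_pow_mul_geometric_of_norm_lt_one 1
      (show ‖q ^ 4‖ < 1 by rwa [Real.norm_of_nonneg (by positivity)])
    have e2 := summable_geometric_of_lt_one (by positivity) hq4
    refine (e1.add e2).congr fun m => ?_
    ring
  set W : ℝ := ∑' m : ℕ, ((m : ℝ) + 1) * (q ^ 4) ^ m with hW
  have hW0 : 0 ≤ W := tsum_nonneg fun m => by positivity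
  set P : ℝ := 3 + 2 * (1 - q)⁻¹ with hP
  have hP0 : 0 < P := by positivity
  refine ⟨P * (1 + 2 * K * W), by positivity, fun c hc => ?_⟩
  set B : ℝ := ∑' k : ℤ, (1 + |(k : ℝ)| ^ 2) ^ γ * ‖c k‖ ^ 2 with hB
  have hB0 : 0 ≤ B := tsum_nonneg fun k => by positivity
  have hc0 : ‖c 0‖ₑ ^ 4 ≤ ENNReal.ofReal (B ^ 2) := by
    have h := hc.le_tsum 0 fun k _ => by positivity
    have h' : ‖c 0‖ ^ 2 ≤ B := by simpa [hB] using h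
    rw [← ofReal_norm, ← ENNReal.ofReal_pow (norm_nonneg _)]
    refine ENNReal.ofReal_le_ofReal ?_
    calc ‖c 0‖ ^ 4 = (‖c 0‖ ^ 2) ^ 2 := by ring
      _ ≤ B ^ 2 := by gcongr
  set a : ℕ → ℝ → ℝ≥0∞ := blockSup α (fun k => c (k : ℤ)) with hadef
  set b : ℕ → ℝ → ℝ≥0∞ := blockSup α (fun k => c (-(k : ℤ))) with hbdef
  have ham : ∀ m, Measurable (a m) := measurable_blockSup α _
  have hbm : ∀ m, Measurable (b m) := measurable_blockSup α _
  have hia : ∀ m, ∫⁻ t in Set.Ioo (0 : ℝ) 1, a m t ^ 4 ≤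
      ENNReal.ofReal (K * (m + 1) * (q ^ m) ^ 8 * B ^ 2) :=
    lintegral_blockSup_pow_four_le_of_sobolev α γ h0 hα1 hγ0 c hc (fun k => (k : ℤ))
      Nat.cast_injective (fun k => by simp)
  have hib : ∀ m, ∫⁻ t in Set.Ioo (0 : ℝ) 1, b m t ^ 4 ≤
      ENNReal.ofReal (K * (m + 1) * (q ^ m) ^ 8 * B ^ 2) :=
    lintegral_blockSup_pow_four_le_of_sobolev α γ h0 hα1 hγ0 c hc (fun k => -(k : ℤ))
      (neg_injective.comp Nat.cast_injective) (fun k => by simp)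
  set r : ℝ≥0∞ := ENNReal.ofReal q with hr
  have hr0 : r ≠ 0 := by simpa [hr] using hq0
  have hrP : 3 + 2 * ∑' m : ℕ, r ^ m = ENNReal.ofReal P := by
    rw [ENNReal.tsum_geometric, hP, ENNReal.ofReal_add (by norm_num) (by positivity),
      ENNReal.ofReal_mul zero_le_two, ENNReal.ofReal_inv_of_pos hq1', ENNReal.ofReal_sub _ hq0.le]
    simp [hr]
  have hweight : ∀ m : ℕ, (r ^ m)⁻¹ ^ 4 * ENNReal.ofReal (K * (m + 1) * (q ^ m) ^ 8 * B ^ 2) =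
      ENNReal.ofReal (K * B ^ 2 * ((m + 1) * (q ^ 4) ^ m)) := by
    intro m
    rw [hr, ← ENNReal.ofReal_pow hq0.le, ← ENNReal.ofReal_inv_of_pos (by positivity),
      ← ENNReal.ofReal_pow (by positivity), ← ENNReal.ofReal_mul (by positivity)]
    congr 1
    rw [← pow_mul q 4 m, mul_comm 4 m, pow_mul q m 4]
    field_simp
  calc _ ≤ ∫⁻ t in Set.Ioo (0 : ℝ) 1, ENNReal.ofReal P ^ 4 * (‖c 0‖ₑ ^ 4 +
        ∑' m, ((r ^ m)⁻¹ ^ 4 * a m t ^ 4 + (r ^ m)⁻¹ ^ 4 * b m t ^ 4)) := by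
        refine lintegral_mono fun t => ?_
        rw [← hrP]
        exact (pow_le_pow_left' (iSup_enorm_tsum_int_le α c t) 4).trans
          (tsum_add_tsum_add_pow_four_le _ _ _ r hr0 ENNReal.ofReal_ne_top)
    _ = ENNReal.ofReal P ^ 4 * (‖c 0‖ₑ ^ 4 +
        ∑' m, ((r ^ m)⁻¹ ^ 4 * (∫⁻ t in Set.Ioo (0 : ℝ) 1, a m t ^ 4) +
          (r ^ m)⁻¹ ^ 4 * ∫⁻ t in Set.Ioo (0 : ℝ) 1, b m t ^ 4)) := by
        rw [lintegral_const_mul _ (by fun_prop), lintegral_add_left measurable_const,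
          setLIntegral_const, Real.volume_Ioo, sub_zero, ENNReal.ofReal_one, mul_one,
          lintegral_tsum fun m => by fun_prop]
        congr 2
        refine tsum_congr fun m => ?_
        rw [lintegral_add_left (by fun_prop), lintegral_const_mul _ (by fun_prop),
          lintegral_const_mul _ (by fun_prop)]
    _ ≤ ENNReal.ofReal P ^ 4 * (ENNReal.ofReal (B ^ 2) +
        ∑' m : ℕ, (ENNReal.ofReal (K * B ^ 2 * ((m + 1) * (q ^ 4) ^ m)) +
          ENNReal.ofReal (K * B ^ 2 * ((m + 1) * (q ^ 4) ^ m)))) := by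
        simp only [← hweight]
        gcongr with m m
        · exact hia m
        · exact hib m
    _ = ENNReal.ofReal (P ^ 4 * ((1 + 2 * K * W) * B ^ 2)) := by
        rw [ENNReal.tsum_add, ← ENNReal.ofReal_tsum_of_nonneg (fun m => by positivity)
          (hWs.mul_left _), tsum_mul_left, ← ENNReal.ofReal_add (by positivity) (by positivity),
          ← ENNReal.ofReal_add (by positivity) (by positivity), ← ENNReal.ofReal_pow hP0.le,
          ← ENNReal.ofReal_mul (by positivity)]
        congr 1
        ring
    _ ≤ _ := by
        rw [← ENNReal.ofReal_pow (by positivity)]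
        refine ENNReal.ofReal_le_ofReal ?_
        have h4 : √B ^ 4 = B ^ 2 := by
          rw [show √B ^ 4 = (√B ^ 2) ^ 2 by ring, Real.sq_sqrt hB0]
        have h5 : 1 + 2 * K * W ≤ (1 + 2 * K * W) ^ 4 :=
          le_self_pow₀ (by have : 0 ≤ 2 * K * W := by positivity
                           linarith) four_ne_zero
        rw [mul_pow, mul_pow, h4, mul_assoc (P ^ 4)]
        gcongr
end
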